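/- arXiv:1812.05346 — 6 statements merged into one kernel-verified Lean document; each statement's English description precedes it below -/
import Mathlib

section
/- Let r > 0 and α ∈ ℝ, and suppose that r·cos(πα/2) and (1/r)·sin(πα/2) are linearly independent over ℤ, i.e. the only pair of integers (j,k) with j·r·cos(πα/2) + k·(1/r)·sin(πα/2) = 0 is (0,0) (in particular sin(πα/2) ≠ 0). Then the fractional Fourier transform of the Dirac comb 𝓕^α Ш_r has full support: for every nonempty open set U ⊆ ℝ there exists a Schwartz function f : ℝ → ℂ whose support is contained in U and such that √r·∑_{k∈ℤ} (𝓕^α f)(rk) ≠ 0. -/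
open MeasureTheory

/-- The fractional Fourier transform of a function `f : ℝ → ℂ`, for `α` with
`sin (πα/2) ≠ 0`, with the square root of positive real part given by the
principal complex power. -/
noncomputable def frFT (α : ℝ) (f : ℝ → ℂ) (x : ℝ) : ℂ :=
  (Complex.I * (Real.sin (Real.pi * α / 2) : ℂ)) ^ (-(1/2) : ℂ) *
    ∫ y : ℝ, Complex.exp ((Real.pi : ℂ) * Complex.I / (Real.sin (Real.pi * α / 2) : ℂ) *
      ((Real.cos (Real.pi * α / 2) * (x ^ 2 + y ^ 2) - 2 * x * y : ℝ) : ℂ)) * f y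

/-- The pairing `⟨𝓕^α Ш_r, f⟩ = √r · ∑_{k ∈ ℤ} (𝓕^α f)(rk)`. -/
noncomputable def frftCombPair (r α : ℝ) (f : ℝ → ℂ) : ℂ :=
  (Real.sqrt r : ℂ) * ∑' k : ℤ, frFT α f (r * k)

open scoped SchwartzMap in
/-- The samples of a Schwartz function along a lattice are summable. -/
theorem SchwartzMap.summable_norm_int_mul (f : 𝓢(ℝ, ℂ)) {b : ℝ} (hb : b ≠ 0) :
    Summable fun k : ℤ ↦ ‖f (b * k)‖ := by
  have htend : Filter.Tendsto (fun k : ℤ ↦ b * (k : ℝ)) Filter.cofinite (Filter.cocompact ℝ) :=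
    (Homeomorph.mulLeft₀ b hb).isClosedEmbedding.tendsto_cocompact.comp Int.tendsto_coe_cofinite
  have hO := (f.isBigO_cocompact_rpow (-2)).comp_tendsto htend
  refine (summable_of_isBigO ?_ hO).norm
  refine ((Real.summable_abs_int_rpow one_lt_two).mul_left (|b| ^ (-2 : ℝ))).congr fun k ↦ ?_
  simp only [Function.comp_apply, Real.norm_eq_abs, abs_mul]
  rw [Real.mul_rpow (abs_nonneg _) (abs_nonneg _)]

/-- An absolutely convergent Fourier series which vanishes on a dense orbit of a rotation has
zero constant coefficient. -/
theorem coeff_zero_eq_zero_of_tsum_fourier_eq_zero {θ : ℝ} (hθ : Irrational θ) {a : ℤ → ℂ}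
    (ha : Summable fun k ↦ ‖a k‖)
    (h : ∀ l : ℤ, ∑' k : ℤ, a k * fourier k ((l * θ : ℝ) : UnitAddCircle) = 0) : a 0 = 0 := by
  have hs : Summable fun k : ℤ ↦ a k • (fourier k : C(UnitAddCircle, ℂ)) :=
    Summable.of_norm (by simpa only [norm_smul, fourier_norm, mul_one] using ha)
  set F : C(UnitAddCircle, ℂ) := ∑' k : ℤ, a k • fourier k with hF
  have hF0 : (F : UnitAddCircle → ℂ) = 0 := by
    have hd : DenseRange (· • (θ : UnitAddCircle) : ℤ → UnitAddCircle) :=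
      AddCircle.denseRange_zsmul_coe_iff.2 (by simpa using hθ)
    refine hd.equalizer F.continuous continuous_const (funext fun l ↦ ?_)
    change F (l • (θ : UnitAddCircle)) = 0
    rw [hF, ← ContinuousMap.tsum_apply hs, ← AddCircle.coe_zsmul, zsmul_eq_mul]
    exact h l
  have hnorm : ∀ (k : ℤ) (t : UnitAddCircle), ‖a k * fourier k t‖ = ‖a k‖ := fun k t ↦ by
    rw [norm_mul, fourier_apply, Circle.norm_coe, mul_one]
  have hint := hasSum_integral_of_summable_integral_norm
    (μ := AddCircle.haarAddCircle (T := 1)) (F := fun (k : ℤ) t ↦ a k * fourier k t)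
    (fun k ↦ (continuous_const.mul (map_continuous (fourier k))).integrable_of_hasCompactSupport
      (HasCompactSupport.of_compactSpace _))
    (by simp only [hnorm, integral_const, probReal_univ, one_smul]; exact ha)
  have hcoeff : ∀ k : ℤ, ∫ t, a k * fourier k t ∂(AddCircle.haarAddCircle (T := 1)) =
      if k = 0 then a 0 else 0 := fun k ↦ by
    have hk := congrFun (fourierCoeff_fourier (T := 1) k) 0
    simp only [fourierCoeff, neg_zero, fourier_zero, one_smul] at hk
    rw [integral_const_mul, hk]
    rcases eq_or_ne k 0 with rfl | h0
    · simp
    · simp [h0, h0.symm]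
  have hF0' : ∀ t : UnitAddCircle, ∑' k : ℤ, a k * fourier k t = 0 := fun t ↦ by
    have ht : F t = 0 := congrFun hF0 t
    rwa [hF, ← ContinuousMap.tsum_apply hs] at ht
  simp only [hcoeff, hF0', integral_zero] at hint
  exact (hasSum_ite_eq 0 (a 0)).unique hint

/-- The fractional Fourier transform of a function multiplied with a suitable chirp is an
ordinary Fourier transform up to a phase. -/
theorem frFT_chirp_mul (r α : ℝ) (hs : Real.sin (Real.pi * α / 2) ≠ 0) (g : ℝ → ℂ) (k l : ℤ) :
    frFT α (fun y ↦ Complex.exp ((Real.pi * (2 * r * l * y - Real.cos (Real.pi * α / 2) * y ^ 2) /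
        Real.sin (Real.pi * α / 2) : ℝ) * Complex.I) * g y) (r * k) =
      (Complex.I * (Real.sin (Real.pi * α / 2) : ℂ)) ^ (-(1/2) : ℂ) *
        (Complex.exp ((Real.pi * (Real.cos (Real.pi * α / 2) * r ^ 2 /
          Real.sin (Real.pi * α / 2)) * k ^ 2 : ℝ) * Complex.I) *
        FourierTransform.fourier g (r / Real.sin (Real.pi * α / 2) * (k - l : ℤ))) := by
  rw [frFT, Real.fourier_real_eq_integral_exp_smul]
  congr 1
  rw [← integral_const_mul]
  congr 1
  funext y
  rw [smul_eq_mul, ← mul_assoc, ← mul_assoc (Complex.exp _) (Complex.exp _) (g y),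
    ← Complex.exp_add, ← Complex.exp_add]
  have hs' : (Real.sin (Real.pi * α / 2) : ℂ) ≠ 0 := by exact_mod_cast hs
  generalize Real.sin (Real.pi * α / 2) = s at *
  generalize Real.cos (Real.pi * α / 2) = c at *
  congr 2
  push_cast
  field_simp
  ring

/-- If `r cos(πα/2)` and `(1/r) sin(πα/2)` are linearly independent over `ℤ`, then
`𝓕^α Ш_r` has full support. -/
theorem stmt0 (r α : ℝ) (hr : 0 < r)
    (hindep : ∀ j k : ℤ,
      (j : ℝ) * (r * Real.cos (Real.pi * α / 2))
        + (k : ℝ) * ((1 / r) * Real.sin (Real.pi * α / 2)) = 0 → j = 0 ∧ k = 0) :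
    ∀ U : Set ℝ, IsOpen U → U.Nonempty →
      ∃ f : SchwartzMap ℝ ℂ, Function.support (⇑f) ⊆ U ∧ frftCombPair r α (⇑f) ≠ 0 := by
  intro U hU ⟨x, hx⟩
  have hs : Real.sin (Real.pi * α / 2) ≠ 0 := fun h ↦ by
    have := (hindep 0 1 (by simp [h])).2
    simp at this
  by_contra! hcon
  obtain ⟨ε, hε, hεU⟩ := Metric.isOpen_iff.1 hU x hx
  let φ : ContDiffBump x := ⟨ε / 2, ε, by positivity, by linarith⟩
  let g : SchwartzMap ℝ ℂ := (φ.hasCompactSupport.comp_left Complex.ofReal_zero).toSchwartzMap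
    (Complex.ofRealCLM.contDiff.comp φ.contDiff)
  have hg : ∀ y, g y = (φ y : ℂ) := fun y ↦ rfl
  set s := Real.sin (Real.pi * α / 2) with hs_def
  set c := Real.cos (Real.pi * α / 2) with hc_def
  let θ : ℝ := c * r ^ 2 / s
  have hθ : Irrational θ := by
    rintro ⟨q, hq⟩
    have hq' : (q.den : ℝ) * (c * r ^ 2) = q.num * s := by
      have h1 : c * r ^ 2 = q * s := by rw [hq]; exact (div_mul_cancel₀ _ hs).symm
      have h2 : (q : ℝ) * q.den = q.num := by exact_mod_cast q.mul_den_eq_num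
      rw [h1, ← h2]; ring
    have := (hindep q.den (-q.num) (by
      push_cast
      field_simp
      linarith)).1
    exact q.den_nz (by exact_mod_cast this)
  have hpre : (Complex.I * (s : ℂ)) ^ (-(1/2) : ℂ) ≠ 0 := by
    simp [Complex.cpow_eq_zero_iff, hs]
  have hrs : r / s ≠ 0 := div_ne_zero hr.ne' hs
  let e : ℤ → ℂ := fun k ↦ Complex.exp ((Real.pi * θ * k ^ 2 : ℝ) * Complex.I)
  have he : ∀ k, ‖e k‖ = 1 := fun k ↦ Complex.norm_exp_ofReal_mul_I _
  have hsum : Summable fun k : ℤ ↦ ‖e k * FourierTransform.fourier g (r / s * k)‖ := by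
    simpa only [norm_mul, he, one_mul] using
      (FourierTransform.fourier g).summable_norm_int_mul hrs
  have hzero : e 0 * FourierTransform.fourier g (r / s * (0 : ℤ)) = 0 := by
    refine coeff_zero_eq_zero_of_tsum_fourier_eq_zero hθ hsum fun l ↦ ?_
    let p : ℝ → ℂ := fun y ↦ Complex.exp ((Real.pi * (2 * r * l * y - c * y ^ 2) / s : ℝ) *
      Complex.I)
    have hp : ContDiff ℝ ((⊤ : ℕ∞) : WithTop ℕ∞) p := by
      have hq : ContDiff ℝ ((⊤ : ℕ∞) : WithTop ℕ∞)
          (fun y : ℝ ↦ Real.pi * (2 * r * l * y - c * y ^ 2) / s) := by fun_prop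
      exact ((Complex.ofRealCLM.contDiff.comp hq).mul contDiff_const).cexp
    let f : SchwartzMap ℝ ℂ := (HasCompactSupport.mul_left (f := p)
      (φ.hasCompactSupport.comp_left Complex.ofReal_zero)).toSchwartzMap
      (hp.mul (Complex.ofRealCLM.contDiff.comp φ.contDiff))
    have hf : (f : ℝ → ℂ) = fun y ↦ p y * g y := rfl
    have hfU : Function.support f ⊆ U := by
      intro y hy
      refine hεU ?_
      change y ∈ Metric.ball x φ.rOut
      rw [← φ.support_eq]
      intro h0
      exact hy (by rw [hf]; simp [hg, h0])
    have h0 := hcon f hfU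
    rw [frftCombPair, hf] at h0
    simp only [p, hs_def, hc_def] at h0
    simp only [frFT_chirp_mul r α hs, tsum_mul_left] at h0
    simp only [← hs_def, ← hc_def] at h0
    have h1 := ((mul_eq_zero.1 h0).resolve_left (by
      exact_mod_cast (Real.sqrt_pos.2 hr).ne')
      |> mul_eq_zero.1).resolve_left hpre
    rw [← (Equiv.addRight l).tsum_eq] at h1
    refine (mul_eq_zero.1 (?_ : e l * _ = 0)).resolve_left (Complex.exp_ne_zero _)
    rw [← tsum_mul_left, ← h1]
    refine tsum_congr fun k ↦ ?_
    rw [fourier_coe_apply, SchwartzMap.fourier_coe]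
    simp only [Equiv.coe_addRight, add_sub_cancel_right, e]
    rw [mul_right_comm (Complex.exp _), ← mul_assoc, ← mul_assoc, ← Complex.exp_add, ← Complex.exp_add]
    congr 2
    simp only [θ]
    push_cast
    ring
  have hg0 : FourierTransform.fourier g (r / s * (0 : ℤ)) = ((∫ y, φ y : ℝ) : ℂ) := by
    rw [SchwartzMap.fourier_coe, Real.fourier_real_eq_integral_exp_smul, ← integral_complex_ofReal]
    simp [hg]
  rw [hg0] at hzero
  refine (mul_ne_zero (Complex.exp_ne_zero _) ?_) hzero
  exact_mod_cast (φ.integral_pos (μ := volume)).ne'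
end

section
/- Let r > 0 and α ∈ ℝ, and suppose there exist coprime integers a, b with b ≠ 0 and a real number s > 0 such that exp(πiα/2) = (1/s)·(a/r + i·b·r) (so s = √((a/r)² + (br)²) and sin(πα/2) = br/s ≠ 0). Then 𝓕^α Ш_r is supported in the discrete set {(k + ab/2)/s : k ∈ ℤ}: for every Schwartz function f : ℝ → ℂ whose support is disjoint from {(k + ab/2)/s : k ∈ ℤ}, one has √r·∑_{k∈ℤ} (𝓕^α f)(rk) = 0. -/
open MeasureTheory

open scoped FourierTransform in
/-- Poisson summation for a Schwartz function vanishing on a translate of `ℤ`. -/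
theorem SchwartzMap.tsum_fourier_mul_eq_zero (G : SchwartzMap ℝ ℂ) (x : ℝ)
    (hG : ∀ n : ℤ, G (x + n) = 0) :
    ∑' n : ℤ, 𝓕 (⇑G) n * Complex.exp (2 * Real.pi * Complex.I * n * x) = 0 := by
  have h := SchwartzMap.tsum_eq_tsum_fourier G x
  simp only [hG, tsum_zero, fourier_coe_apply, Complex.ofReal_one, div_one] at h
  exact h.symm

/-- The function `t ↦ exp (it)` has temperate growth. -/
theorem Complex.hasTemperateGrowth_exp_ofReal_mul_I :
    (fun t : ℝ ↦ Complex.exp (t * Complex.I)).HasTemperateGrowth := by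
  have hd (n : ℕ) : iteratedDeriv n (fun t : ℝ ↦ Complex.exp (t * Complex.I)) =
      fun t : ℝ ↦ Complex.I ^ n * Complex.exp (t * Complex.I) := by
    induction n with
    | zero => simp
    | succ n ih =>
      rw [iteratedDeriv_succ, ih]
      ext t
      have h : HasDerivAt (fun t : ℝ ↦ Complex.exp (t * Complex.I))
          (Complex.exp (t * Complex.I) * (1 * Complex.I)) t :=
        ((Complex.ofRealCLM.hasDerivAt (x := t)).mul_const Complex.I).cexp
      rw [(h.const_mul _).deriv]
      ring
  refine ⟨?_, fun n ↦ ⟨0, 1, fun t ↦ ?_⟩⟩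
  · exact (Complex.ofRealCLM.contDiff.mul contDiff_const).cexp
  · rw [norm_iteratedFDeriv_eq_norm_iteratedDeriv, hd]
    simp [Complex.norm_exp_ofReal_mul_I]

/-- A series over `ℤ` vanishes if its sums over all residue classes modulo `b` vanish. -/
theorem tsum_int_eq_zero_of_residue_classes {F : ℤ → ℂ} {b : ℤ} (hb : b ≠ 0)
    (h : ∀ l : ℤ, ∑' n : ℤ, F (l + b * n) = 0) : ∑' k : ℤ, F k = 0 := by
  by_cases hF : Summable F
  swap
  · exact tsum_eq_zero_of_not_summable hF
  have key (N : ℕ) (hN : N ≠ 0) (hl : ∀ l : ℤ, ∑' n : ℤ, F (l + N * n) = 0) :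
      ∑' k : ℤ, F k = 0 := by
    have : NeZero N := ⟨hN⟩
    let e := (Equiv.prodComm (Fin N) ℤ).trans (Int.divModEquiv N).symm
    have he : Summable (F ∘ e) := e.summable_iff.mpr hF
    rw [← e.tsum_eq F]
    refine (he.tsum_prod).trans ?_
    refine (tsum_congr fun i ↦ ?_).trans tsum_zero
    rw [← hl (i : ℕ)]
    refine tsum_congr fun n ↦ ?_
    simp [e, Int.divModEquiv, add_comm, mul_comm]
  rcases Int.natAbs_eq b with hb' | hb'
  · exact key b.natAbs (by simpa using hb) fun l ↦ by rw [← hb']; exact h l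
  · refine key b.natAbs (by simpa using hb) fun l ↦ ?_
    rw [← h l, ← (Equiv.neg ℤ).tsum_eq fun n : ℤ ↦ F (l + b * n)]
    refine tsum_congr fun n ↦ ?_
    congr 2
    conv_rhs => rw [hb']
    simp

/-- A Schwartz function, dilated by `s` and multiplied by a quadratic phase, is Schwartz. -/
theorem SchwartzMap.exists_chirp_mul_dilate (f : SchwartzMap ℝ ℂ) (p q : ℝ) {s : ℝ} (hs : s ≠ 0) :
    ∃ G : SchwartzMap ℝ ℂ, ∀ u : ℝ,
      G u = Complex.exp (((p * u ^ 2 + q * u : ℝ) : ℂ) * Complex.I) * f (u / s) := by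
  have hg : (fun u : ℝ ↦ p * u ^ 2 + q * u).HasTemperateGrowth := by
    fun_prop
  have hc := Complex.hasTemperateGrowth_exp_ofReal_mul_I.comp hg
  let e : ℝ ≃L[ℝ] ℝ := ContinuousLinearEquiv.unitsEquivAut ℝ (Units.mk0 s⁻¹ (inv_ne_zero hs))
  refine ⟨SchwartzMap.smulLeftCLM ℂ
    ((fun t : ℝ ↦ Complex.exp (t * Complex.I)) ∘ fun u : ℝ ↦ p * u ^ 2 + q * u)
    (SchwartzMap.compCLMOfContinuousLinearEquiv ℂ e f), fun u ↦ ?_⟩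
  rw [SchwartzMap.smulLeftCLM_apply_apply hc]
  simp [e, div_eq_mul_inv]

/-- If `exp(πiα/2) = (1/s)(a/r + i b r)` with `a, b` coprime integers, `b ≠ 0`, `s > 0`,
then `𝓕^α Ш_r` is supported in `{(k + ab/2)/s : k ∈ ℤ}`. -/
theorem stmt1 (r α s : ℝ) (a b : ℤ) (hr : 0 < r) (hab : IsCoprime a b) (hb : b ≠ 0)
    (hs : 0 < s)
    (hexp : Complex.exp ((Real.pi : ℂ) * Complex.I * (α : ℂ) / 2)
      = (1 / (s : ℂ)) * ((a : ℂ) / (r : ℂ) + Complex.I * (b : ℂ) * (r : ℂ))) :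
    ∀ f : SchwartzMap ℝ ℂ,
      (∀ x ∈ Function.support (⇑f), ∀ k : ℤ, x ≠ ((k : ℝ) + (a : ℝ) * (b : ℝ) / 2) / s) →
      frftCombPair r α (⇑f) = 0 := by
  intro f hf
  have hrC : (r : ℂ) ≠ 0 := by exact_mod_cast hr.ne'
  have hsC : (s : ℂ) ≠ 0 := by exact_mod_cast hs.ne'
  have hbC : (b : ℂ) ≠ 0 := by exact_mod_cast hb
  have hexp' : Complex.exp (((Real.pi * α / 2 : ℝ) : ℂ) * Complex.I) =
      ((a / (r * s) : ℝ) : ℂ) + ((b * r / s : ℝ) : ℂ) * Complex.I := by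
    rw [show ((Real.pi * α / 2 : ℝ) : ℂ) * Complex.I = Real.pi * Complex.I * α / 2 by
      push_cast; ring, hexp]
    push_cast
    field_simp
  have hcos : Real.cos (Real.pi * α / 2) = a / (r * s) := by
    rw [← Complex.exp_ofReal_mul_I_re, hexp']
    simp only [Complex.add_re, Complex.ofReal_re, Complex.re_ofReal_mul, Complex.I_re, mul_zero,
      add_zero]
  have hsin : Real.sin (Real.pi * α / 2) = b * r / s := by
    rw [← Complex.exp_ofReal_mul_I_im, hexp']
    simp only [Complex.add_im, Complex.ofReal_im, Complex.im_ofReal_mul, Complex.I_im, mul_one,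
      zero_add]
  rw [frftCombPair, tsum_int_eq_zero_of_residue_classes hb, mul_zero]
  intro l
  obtain ⟨G, hG⟩ := f.exists_chirp_mul_dilate (Real.pi * a / (s ^ 2 * b * r ^ 2))
    (-(2 * Real.pi * l / b)) hs.ne'
  have hG0 (n : ℤ) : G ((a : ℝ) * b / 2 + n) = 0 := by
    rw [hG, mul_eq_zero]
    right
    by_contra hne
    exact hf _ hne n (by ring)
  have hpoisson := G.tsum_fourier_mul_eq_zero _ hG0
  set c : ℂ := (Complex.I * (Real.sin (Real.pi * α / 2) : ℂ)) ^ (-(1/2) : ℂ) with hc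
  have hterm (n : ℤ) : frFT α f (r * ((l + b * n : ℤ) : ℝ)) =
      c * Complex.exp (Real.pi * Complex.I * a * l ^ 2 / b) * (s : ℂ)⁻¹ *
        (FourierTransform.fourier (⇑G) (n : ℝ) *
          Complex.exp (2 * Real.pi * Complex.I * n * ((a * b / 2 : ℝ) : ℂ))) := by
    have hscale : FourierTransform.fourier (⇑G) (n : ℝ) =
        s * ∫ y : ℝ, Complex.exp (((-2 * Real.pi * (s * y) * n : ℝ) : ℂ) * Complex.I) *
          G (s * y) := by
      have h := Measure.integral_comp_mul_left
        (fun v : ℝ ↦ Complex.exp (((-2 * Real.pi * v * n : ℝ) : ℂ) * Complex.I) * G v) s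
      rw [h, Real.fourier_real_eq_integral_exp_smul, abs_of_pos (inv_pos.mpr hs),
        Complex.real_smul, Complex.ofReal_inv, mul_inv_cancel_left₀ hsC]
      rfl
    have hphase (y : ℝ) :
        Complex.exp ((Real.pi : ℂ) * Complex.I / (Real.sin (Real.pi * α / 2) : ℂ) *
          ((Real.cos (Real.pi * α / 2) * ((r * ((l + b * n : ℤ) : ℝ)) ^ 2 + y ^ 2) -
            2 * (r * ((l + b * n : ℤ) : ℝ)) * y : ℝ) : ℂ)) * f y =
        (Complex.exp (Real.pi * Complex.I * a * l ^ 2 / b) *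
          Complex.exp (2 * Real.pi * Complex.I * n * ((a * b / 2 : ℝ) : ℂ))) *
        (Complex.exp (((-2 * Real.pi * (s * y) * n : ℝ) : ℂ) * Complex.I) * G (s * y)) := by
      have hprod (A B C D z : ℂ) : Complex.exp A * Complex.exp B *
          (Complex.exp C * (Complex.exp D * z)) = Complex.exp (A + B + C + D) * z := by
        simp only [Complex.exp_add]
        ring
      rw [hG, mul_div_cancel_left₀ y hs.ne', hprod]
      congr 1
      obtain ⟨m, hm⟩ := Int.even_mul_pred_self n
      have hmC : (n : ℂ) * (n - 1) = m + m := by exact_mod_cast hm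
      rw [Complex.exp_eq_exp_iff_exists_int]
      refine ⟨a * l * n + a * b * m, ?_⟩
      rw [hsin, hcos]
      push_cast
      have hm' : (m : ℂ) = n * (n - 1) / 2 := by rw [hmC]; ring
      rw [hm']
      field_simp
      ring
    rw [frFT, ← hc, hscale, integral_congr_ae (Filter.Eventually.of_forall hphase),
      integral_const_mul]
    have halg (A B J : ℂ) : c * (A * B * J) = c * A * (s : ℂ)⁻¹ * (s * J * B) := by
      field_simp
    exact halg _ _ _
  simp_rw [hterm]
  rw [tsum_mul_left]
  rw [hpoisson, mul_zero]
end

section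
/- Let r > 0 and α ∈ ℝ, and suppose there exist coprime integers a, b with b ≠ 0 and s > 0 such that exp(πiα/2) = (1/s)·(a/r + i·b·r) (so s = √((a/r)² + (br)²)). Let c, d ∈ ℤ with ad − bc = 1 and set t = ac/r² + b·d·r². Then there exists μ₀ ∈ ℂ with μ₀ ≠ 0 such that for every Schwartz function f : ℝ → ℂ: √r·∑_{j∈ℤ} (𝓕^α f)(rj) = μ₀·s^(−1/2)·∑_{k∈ℤ} exp(−πi·t·(k + ab/2)²/s² − πi·c·d·(k + ab/2))·f((k + ab/2)/s). (In words: 𝓕^α Ш_r equals μ₀·e^(−πi t x² − πi c d s x)·Ш_{1/s}(x − ab/(2s)) as a tempered distribution.) -/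
open MeasureTheory

open scoped SchwartzMap FourierTransform
open Complex (I)

theorem hasTemperateGrowth_cexp_I_mul_ofReal :
    (fun x : ℝ => Complex.exp (I * x)).HasTemperateGrowth := by
  refine ⟨(contDiff_const.mul Complex.ofRealCLM.contDiff).cexp, fun n => ⟨0, 1, fun x => ?_⟩⟩
  have h : ∀ m : ℕ, iteratedDeriv m (fun x : ℝ => Complex.exp (I * x))
      = fun x : ℝ => I ^ m * Complex.exp (I * x) := by
    intro m
    induction m with
    | zero => simp
    | succ m ih =>
      rw [iteratedDeriv_succ, ih]
      ext y
      have h₁ : HasDerivAt (fun x : ℝ => I * (x : ℂ)) I y := by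
        simpa using (Complex.ofRealCLM.hasDerivAt (x := y)).const_mul I
      rw [(h₁.cexp.const_mul (I ^ m)).deriv]
      ring
  rw [norm_iteratedFDeriv_eq_norm_iteratedDeriv, h]
  simp [mul_comm I, Complex.norm_exp_ofReal_mul_I]

/-- Dilates of a Schwartz function times a quadratic phase are Schwartz. -/
theorem exists_schwartz_chirp_mul_dilate (f : 𝓢(ℝ, ℂ)) (κ l : ℝ) {σ : ℝ} (hσ : σ ≠ 0) :
    ∃ g : 𝓢(ℝ, ℂ), ∀ y : ℝ,
      g y = Complex.exp (Real.pi * I * ((κ * y ^ 2 - 2 * l * y : ℝ) : ℂ)) * f (y / σ) := by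
  have hp : (fun y : ℝ => Real.pi * (κ * y ^ 2 - 2 * l * y)).HasTemperateGrowth := by fun_prop
  have hE := hasTemperateGrowth_cexp_I_mul_ofReal.comp hp
  let e : ℝ ≃L[ℝ] ℝ := ContinuousLinearEquiv.unitsEquivAut ℝ (Units.mk0 σ⁻¹ (inv_ne_zero hσ))
  refine ⟨SchwartzMap.smulLeftCLM ℂ ((fun x : ℝ => Complex.exp (I * x)) ∘
    fun y : ℝ => Real.pi * (κ * y ^ 2 - 2 * l * y))
    (SchwartzMap.compCLMOfContinuousLinearEquiv ℂ e f),
    fun y => ?_⟩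
  rw [SchwartzMap.smulLeftCLM_apply_apply hE]
  have : e y = y / σ := by simp [e, div_eq_mul_inv]
  simp only [SchwartzMap.compCLMOfContinuousLinearEquiv_apply, Function.comp_apply, this,
    smul_eq_mul]
  congr 2
  push_cast
  ring

/-- The Fourier transform at `u` of the function `z ↦ exp (π i q z²) f z`. -/
noncomputable def chirpFourier (q : ℝ) (f : ℝ → ℂ) (u : ℝ) : ℂ :=
  ∫ z : ℝ, Complex.exp (Real.pi * I * ((q * z ^ 2 - 2 * u * z : ℝ) : ℂ)) * f z

theorem fourier_chirp_mul_dilate {f g : ℝ → ℂ} {q l σ : ℝ} (hσ : σ ≠ 0)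
    (hg : ∀ y : ℝ, g y =
      Complex.exp (Real.pi * I * ((q / σ ^ 2 * y ^ 2 - 2 * l * y : ℝ) : ℂ)) * f (y / σ)) (u : ℝ) :
    𝓕 g u = |σ| * chirpFourier q f (σ * (l + u)) := by
  rw [Real.fourier_real_eq_integral_exp_smul]
  have h := Measure.integral_comp_div (fun z : ℝ =>
    Complex.exp (Real.pi * I * ((q * z ^ 2 - 2 * (σ * (l + u)) * z : ℝ) : ℂ)) * f z) σ
  rw [Complex.real_smul] at h
  rw [chirpFourier, ← h]
  congr 1
  ext y
  rw [hg, smul_eq_mul, ← mul_assoc, ← Complex.exp_add]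
  congr 2
  have : (σ : ℂ) ≠ 0 := by exact_mod_cast hσ
  push_cast
  field_simp
  ring

theorem SchwartzMap.summable_int (f : 𝓢(ℝ, ℂ)) (x : ℝ) : Summable fun n : ℤ => f (x + n) := by
  obtain ⟨g, hg⟩ : ∃ g : 𝓢(ℝ, ℂ), ∀ y, g y = f (x + y) :=
    ⟨SchwartzMap.compSubConstCLM ℂ (-x) f, fun y => by simp [add_comm]⟩
  simp_rw [← hg]
  exact summable_of_isBigO (Real.summable_abs_int_rpow one_lt_two)
    ((g.isBigO_cocompact_rpow (-2)).comp_tendsto Int.tendsto_coe_cofinite)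

theorem summable_chirpFourier (f : 𝓢(ℝ, ℂ)) (q : ℝ) {σ : ℝ} (hσ : σ ≠ 0) :
    Summable fun n : ℤ => chirpFourier q f (σ * n) := by
  obtain ⟨g, hg⟩ := exists_schwartz_chirp_mul_dilate f (q / σ ^ 2) 0 hσ
  have h := (𝓕 g).summable_int 0
  simp_rw [SchwartzMap.fourier_coe, fourier_chirp_mul_dilate hσ hg, zero_add] at h
  rwa [summable_mul_left_iff (by simpa using hσ)] at h

theorem summable_chirp_mul_dilate (f : 𝓢(ℝ, ℂ)) (κ l x : ℝ) {σ : ℝ} (hσ : σ ≠ 0) :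
    Summable fun k : ℤ => Complex.exp (Real.pi * I *
      ((κ * (x + k) ^ 2 - 2 * l * (x + k) : ℝ) : ℂ)) * f ((x + k) / σ) := by
  obtain ⟨g, hg⟩ := exists_schwartz_chirp_mul_dilate f κ l hσ
  simpa only [hg] using g.summable_int x

theorem tsum_chirpFourier (f : 𝓢(ℝ, ℂ)) (q l x : ℝ) {σ : ℝ} (hσ : 0 < σ) :
    ∑' n : ℤ, chirpFourier q f (σ * (l + n)) * Complex.exp (2 * Real.pi * I * n * x)
      = (σ : ℂ)⁻¹ * ∑' k : ℤ, Complex.exp (Real.pi * I *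
        ((q / σ ^ 2 * (x + k) ^ 2 - 2 * l * (x + k) : ℝ) : ℂ)) * f ((x + k) / σ) := by
  obtain ⟨g, hg⟩ := exists_schwartz_chirp_mul_dilate f (q / σ ^ 2) l hσ.ne'
  have h := g.tsum_eq_tsum_fourier x
  simp_rw [SchwartzMap.fourier_coe, fourier_chirp_mul_dilate hσ.ne' hg, hg, mul_assoc ((|σ| : ℝ) : ℂ),
    tsum_mul_left, abs_of_pos hσ] at h
  rw [h, inv_mul_cancel_left₀ (by exact_mod_cast hσ.ne')]
  congr 1
  ext n
  rw [fourier_coe_apply]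
  congr 2
  simp

theorem Summable.tsum_int_eq_sum_residues {F : ℤ → ℂ} (hF : Summable F) {b : ℤ} (hb : b ≠ 0) :
    ∑' j : ℤ, F j = ∑ l ∈ Finset.range b.natAbs, ∑' n : ℤ, F (b * n + l) := by
  have : NeZero b.natAbs := ⟨by simpa using hb⟩
  let e := (Equiv.prodComm (Fin b.natAbs) ℤ).trans (Int.divModEquiv b.natAbs).symm
  have hs : Summable (F ∘ e) := e.summable_iff.mpr hF
  rw [← e.tsum_eq F]
  change ∑' p, (F ∘ e) p = _
  rw [hs.tsum_prod, tsum_fintype, Finset.sum_range]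
  refine Finset.sum_congr rfl fun l _ => ?_
  have he : ∀ n : ℤ, e (l, n) = b.natAbs * n + (l : ℕ) := fun n => by
    simp [e, mul_comm]
  simp only [Function.comp_apply, he]
  rcases Int.natAbs_eq b with h | h
  · rw [← h]
  · have h' : (b.natAbs : ℤ) = -b := by omega
    rw [h', ← (Equiv.neg ℤ).tsum_eq]
    simp

theorem Function.Periodic.sum_range_natAbs_add {F : ℤ → ℂ} {b : ℤ} (hF : F.Periodic b) (m : ℤ) :
    ∑ l ∈ Finset.range b.natAbs, F (l + m) = ∑ l ∈ Finset.range b.natAbs, F l := by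
  have hN : F.Periodic b.natAbs := by
    rcases Int.natAbs_eq b with h | h
    · rwa [← h]
    · rw [show (b.natAbs : ℤ) = -b by omega]
      exact hF.neg
  have step : ∀ m : ℤ, ∑ l ∈ Finset.range b.natAbs, F (l + (m + 1))
      = ∑ l ∈ Finset.range b.natAbs, F (l + m) := fun m => by
    have h₁ := Finset.sum_range_succ (fun l : ℕ => F (l + m)) b.natAbs
    have h₂ := Finset.sum_range_succ' (fun l : ℕ => F (l + m)) b.natAbs
    rw [h₁, add_comm (b.natAbs : ℤ) m, hN m] at h₂
    simp only [Nat.cast_zero, zero_add, add_left_inj] at h₂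
    rw [h₂]
    refine Finset.sum_congr rfl fun l _ => ?_
    congr 1
    push_cast
    ring
  induction m using Int.induction_on with
  | zero => simp
  | succ i ih => rw [step, ih]
  | pred i ih => rw [← ih, ← step (-i - 1), sub_add_cancel]

/-- The quadratic Gauss sum `∑ exp (π i (a l² - 2 (k + a b / 2) l) / b)` over `0 ≤ l < |b|`. -/
noncomputable def chirpGaussSum (a b k : ℤ) : ℂ :=
  ∑ l ∈ Finset.range b.natAbs,
    Complex.exp (Real.pi * I * ((a * l ^ 2 - 2 * k * l) / b - a * l))

theorem exp_pi_I_mul_eq_of_even {x y : ℂ} (n : ℤ) (h : x = y + 2 * n) :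
    Complex.exp (Real.pi * I * x) = Complex.exp (Real.pi * I * y) :=
  Complex.exp_eq_exp_iff_exists_int.mpr ⟨n, by rw [h]; ring⟩

theorem chirpGaussSum_eq {a b c d : ℤ} (hb : b ≠ 0) (hdet : a * d - b * c = 1) (k : ℤ) :
    chirpGaussSum a b k = chirpGaussSum a b 0 *
      Complex.exp (-(Real.pi * I * (d * k ^ 2 / b + a * d * k + c * d * k))) := by
  have hb' : (b : ℂ) ≠ 0 := by exact_mod_cast hb
  have hdet' : (a : ℂ) * d = 1 + b * c := by
    have : a * d = 1 + b * c := by linarith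
    exact_mod_cast this
  have hper : Function.Periodic (fun l : ℤ =>
      Complex.exp (Real.pi * I * (((a : ℂ) * l ^ 2 - 2 * k * l) / b - a * l))) b := fun l => by
    refine exp_pi_I_mul_eq_of_even (a * l - k) ?_
    push_cast
    field_simp
    ring
  have h := hper.sum_range_natAbs_add (d * k)
  simp only [Int.cast_natCast] at h
  rw [chirpGaussSum, ← h, chirpGaussSum, Finset.sum_mul]
  refine Finset.sum_congr rfl fun l _ => ?_
  rw [← Complex.exp_add, ← mul_neg, ← mul_add]
  obtain ⟨n, hn⟩ := Int.even_mul_succ_self k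
  have hn' : (k : ℂ) * (k + 1) = n + n := by exact_mod_cast hn
  refine exp_pi_I_mul_eq_of_even (c * k * l + c * d * n) ?_
  push_cast
  field_simp
  linear_combination (2 * k * l + d * k ^ 2) * hdet' + b * c * d * hn'

theorem chirpGaussSum_zero_ne_zero {a b c d : ℤ} (hb : b ≠ 0) (hdet : a * d - b * c = 1) :
    chirpGaussSum a b 0 ≠ 0 := by
  intro h0
  have hb' : (b : ℂ) ≠ 0 := by exact_mod_cast hb
  have hsum : ∑ k ∈ Finset.range b.natAbs, chirpGaussSum a b k = 0 :=
    Finset.sum_eq_zero fun k _ => by rw [chirpGaussSum_eq hb hdet, h0, zero_mul]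
  simp only [chirpGaussSum] at hsum
  rw [Finset.sum_comm, Finset.sum_eq_single_of_mem 0 (by simpa using hb)] at hsum
  · simp [hb] at hsum
  intro l hl hl0
  have hlt : l < b.natAbs := Finset.mem_range.mp hl
  set w : ℂ := Complex.exp (2 * Real.pi * I * (-l / b)) with hw
  have hterm : ∀ k : ℕ, Complex.exp (Real.pi * I *
      (((a : ℂ) * (l : ℂ) ^ 2 - 2 * ((k : ℤ) : ℂ) * l) / b - a * l))
      = Complex.exp (Real.pi * I * ((a : ℂ) * l ^ 2 / b - a * l)) * w ^ k := fun k => by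
    rw [hw, ← Complex.exp_nat_mul, ← Complex.exp_add]
    congr 1
    push_cast
    field_simp
    ring
  simp_rw [hterm]
  rw [← Finset.mul_sum]
  have hw1 : w ≠ 1 := by
    rw [hw, Ne, Complex.exp_eq_one_iff]
    rintro ⟨n, hn⟩
    have h2 : (-(l : ℂ) / b) = n := by
      have := Complex.two_pi_I_ne_zero
      apply mul_left_cancel₀ this
      rw [hn]; ring
    rw [div_eq_iff hb'] at h2
    have h3 : -(l : ℤ) = n * b := by exact_mod_cast h2
    have h4 : b.natAbs ∣ l := by
      have : b ∣ (l : ℤ) := ⟨-n, by linarith [mul_comm n b]⟩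
      exact Int.natCast_dvd_natCast.mp (Int.natAbs_dvd.mpr this)
    exact absurd (Nat.le_of_dvd (Nat.pos_of_ne_zero hl0) h4) (by omega)
  have hwN : w ^ b.natAbs = 1 := by
    rw [hw, ← Complex.exp_nat_mul, Complex.exp_eq_one_iff]
    rcases Int.natAbs_eq b with h | h
    · refine ⟨-l, ?_⟩
      have h' : ((b.natAbs : ℕ) : ℂ) = b := by rw [← Int.cast_natCast, ← h]
      rw [h']; push_cast; field_simp
    · refine ⟨l, ?_⟩
      have h' : ((b.natAbs : ℕ) : ℂ) = -b := by
        rw [← Int.cast_natCast, show (b.natAbs : ℤ) = -b by omega, Int.cast_neg]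
      rw [h']; push_cast; field_simp
  have := mul_neg_geom_sum w b.natAbs
  rw [hwN, sub_self, mul_eq_zero] at this
  rw [this.resolve_left (sub_ne_zero.mpr hw1.symm), mul_zero]

theorem tsum_exp_mul_chirpFourier (f : 𝓢(ℝ, ℂ)) (q : ℝ) {s : ℝ} (hs : 0 < s) (a : ℤ) {b : ℤ}
    (hb : b ≠ 0) :
    ∑' j : ℤ, Complex.exp (Real.pi * I * (a * j ^ 2 / b)) * chirpFourier q f (s / b * j)
      = (s : ℂ)⁻¹ * ∑' k : ℤ, chirpGaussSum a b k *
        (Complex.exp (Real.pi * I * (q / s ^ 2 * (k + a * b / 2) ^ 2)) *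
          f ((k + a * b / 2) / s)) := by
  have hb' : (b : ℂ) ≠ 0 := by exact_mod_cast hb
  have hbR : (b : ℝ) ≠ 0 := by exact_mod_cast hb
  have hsum : Summable fun j : ℤ =>
      Complex.exp (Real.pi * I * (a * j ^ 2 / b)) * chirpFourier q f (s / b * j) := by
    refine ((summable_chirpFourier f q (div_ne_zero hs.ne' hbR)).norm).of_norm_bounded fun j => ?_
    rw [norm_mul, show (Real.pi * I * (a * j ^ 2 / b) : ℂ)
      = ((Real.pi * (a * j ^ 2 / b) : ℝ) : ℂ) * I by push_cast; ring,
      Complex.norm_exp_ofReal_mul_I, one_mul]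
  have hres : ∀ l : ℕ, ∑' n : ℤ, Complex.exp (Real.pi * I * (a * ((b * n + l : ℤ) : ℂ) ^ 2 / b)) *
        chirpFourier q f (s / b * ((b * n + l : ℤ) : ℝ))
      = ∑' k : ℤ, (s : ℂ)⁻¹ * (Complex.exp (Real.pi * I * (a * l ^ 2 / b)) *
        (Complex.exp (Real.pi * I * ((q / s ^ 2 * (((a * b / 2 : ℝ)) + k) ^ 2 -
          2 * (l / b) * ((a * b / 2 : ℝ) + k) : ℝ) : ℂ)) * f (((a * b / 2 : ℝ) + k) / s))) := by
    intro l
    rw [tsum_mul_left, tsum_mul_left, mul_left_comm, ← tsum_chirpFourier f q _ _ hs,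
      ← tsum_mul_left]
    refine tsum_congr fun n => ?_
    rw [mul_comm (chirpFourier q f _), ← mul_assoc, ← Complex.exp_add]
    congr 1
    · obtain ⟨m, hm⟩ := Int.even_mul_pred_self n
      have hm' : (n : ℂ) * (n - 1) = m + m := by exact_mod_cast hm
      rw [show (2 * Real.pi * I * n * ((a * b / 2 : ℝ) : ℂ) : ℂ)
        = Real.pi * I * (n * a * b) by push_cast; ring, ← mul_add]
      refine exp_pi_I_mul_eq_of_even (a * b * m + a * n * l) ?_
      push_cast
      field_simp
      linear_combination a * b ^ 2 * hm'
    · congr 1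
      push_cast
      field_simp
      ring
  rw [hsum.tsum_int_eq_sum_residues hb, Finset.sum_congr rfl fun l _ => hres l,
    ← Summable.tsum_finsetSum fun l _ =>
      ((summable_chirp_mul_dilate f _ _ _ hs.ne').mul_left _).mul_left _, ← tsum_mul_left]
  refine tsum_congr fun k => ?_
  rw [chirpGaussSum, Finset.sum_mul, Finset.mul_sum]
  refine Finset.sum_congr rfl fun l _ => ?_
  rw [add_comm (k : ℝ), ← mul_assoc (Complex.exp _), ← mul_assoc (Complex.exp _),
    ← Complex.exp_add, ← Complex.exp_add]
  congr 3
  push_cast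
  field_simp
  ring

theorem frFT_eq_chirpFourier {α r s x : ℝ} {a b : ℤ} (f : ℝ → ℂ) (hr : r ≠ 0) (hs : s ≠ 0)
    (hb : b ≠ 0) (hcos : Real.cos (Real.pi * α / 2) = a / (r * s))
    (hsin : Real.sin (Real.pi * α / 2) = b * r / s) :
    frFT α f (r * x) = (I * (Real.sin (Real.pi * α / 2) : ℂ)) ^ (-(1/2) : ℂ) *
      (Complex.exp (Real.pi * I * (a * x ^ 2 / b)) *
        chirpFourier (a / (b * r ^ 2)) f (s / b * x)) := by
  have hb' : (b : ℂ) ≠ 0 := by exact_mod_cast hb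
  have hr' : (r : ℂ) ≠ 0 := by exact_mod_cast hr
  have hs' : (s : ℂ) ≠ 0 := by exact_mod_cast hs
  rw [frFT, chirpFourier]
  congr 1
  rw [← integral_const_mul]
  refine integral_congr_ae (.of_forall fun y => ?_)
  simp only
  rw [← mul_assoc (Complex.exp _), ← Complex.exp_add, hcos, hsin]
  congr 2
  push_cast
  field_simp
  ring

/-- Identification of `𝓕^α Ш_r` as a Dirac brush: there is a nonzero constant `μ₀` so
that `𝓕^α Ш_r = μ₀ s^{-1/2} ∑_k exp(-πi t (k+ab/2)²/s² - πi c d (k+ab/2)) δ(x-(k+ab/2)/s)`. -/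
theorem stmt2 (r α s : ℝ) (a b c d : ℤ) (hr : 0 < r) (hab : IsCoprime a b) (hb : b ≠ 0)
    (hs : 0 < s)
    (hexp : Complex.exp ((Real.pi : ℂ) * Complex.I * (α : ℂ) / 2)
      = (1 / (s : ℂ)) * ((a : ℂ) / (r : ℂ) + Complex.I * (b : ℂ) * (r : ℂ)))
    (hdet : a * d - b * c = 1)
    (t : ℝ) (ht : t = (a : ℝ) * (c : ℝ) / r ^ 2 + (b : ℝ) * (d : ℝ) * r ^ 2) :
    ∃ μ₀ : ℂ, μ₀ ≠ 0 ∧ ∀ f : SchwartzMap ℝ ℂ,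
      frftCombPair r α (⇑f)
        = μ₀ * (s : ℂ) ^ (-(1/2) : ℂ) *
          ∑' k : ℤ, Complex.exp (
              -(Real.pi : ℂ) * Complex.I * (t : ℂ) * ((k : ℂ) + (a : ℂ) * (b : ℂ) / 2) ^ 2 / (s : ℂ) ^ 2
              - (Real.pi : ℂ) * Complex.I * (c : ℂ) * (d : ℂ) * ((k : ℂ) + (a : ℂ) * (b : ℂ) / 2)) *
            f (((k : ℝ) + (a : ℝ) * (b : ℝ) / 2) / s) := by
  have hb' : (b : ℂ) ≠ 0 := by exact_mod_cast hb
  have hr' : (r : ℂ) ≠ 0 := by exact_mod_cast hr.ne'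
  have hs' : (s : ℂ) ≠ 0 := by exact_mod_cast hs.ne'
  have hexp' : (Real.cos (Real.pi * α / 2) : ℂ) + Real.sin (Real.pi * α / 2) * I
      = ((a / (r * s) : ℝ) : ℂ) + ((b * r / s : ℝ) : ℂ) * I := by
    rw [Complex.ofReal_cos, Complex.ofReal_sin, ← Complex.exp_mul_I]
    rw [show (((Real.pi * α / 2 : ℝ) : ℂ) * I) = Real.pi * I * α / 2 by push_cast; ring, hexp]
    push_cast
    field_simp
  have key : ∀ x y u v : ℝ, (x : ℂ) + y * I = u + v * I → x = u ∧ y = v := fun x y u v h => by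
    simpa [Complex.ext_iff] using h
  obtain ⟨hcos, hsin⟩ := key _ _ _ _ hexp'
  have hsin0 : (Real.sin (Real.pi * α / 2) : ℂ) ≠ 0 := by
    rw [hsin]
    push_cast
    positivity
  have hs2 : (s : ℂ) ^ 2 = a ^ 2 / r ^ 2 + b ^ 2 * r ^ 2 := by
    have h := Real.cos_sq_add_sin_sq (Real.pi * α / 2)
    rw [hcos, hsin] at h
    have h' : s ^ 2 = a ^ 2 / r ^ 2 + b ^ 2 * r ^ 2 := by
      field_simp at h ⊢
      linear_combination -h
    exact_mod_cast h'
  have hdet' : (a : ℂ) * d = 1 + b * c := by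
    have : a * d = 1 + b * c := by linarith
    exact_mod_cast this
  have hphase : (a / (b * r ^ 2) + t : ℂ) = d * s ^ 2 / b := by
    rw [hs2, ht]
    push_cast
    field_simp
    linear_combination (-a : ℂ) * hdet'
  set C : ℂ := (I * (Real.sin (Real.pi * α / 2) : ℂ)) ^ (-(1/2) : ℂ) with hC
  have hC0 : C ≠ 0 := fun h =>
    mul_ne_zero Complex.I_ne_zero hsin0 ((Complex.cpow_eq_zero_iff _ _).mp h).1
  set w : ℂ := Complex.exp (Real.pi * I * (d * a ^ 2 * b / 4 + a * b * c * d / 2)) with hw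
  have hsr : (s : ℂ) ^ (-(1/2) : ℂ) ≠ 0 := by simp [Complex.cpow_eq_zero_iff, hs']
  have hrr : (Real.sqrt r : ℂ) ≠ 0 := by exact_mod_cast (Real.sqrt_pos.mpr hr).ne'
  refine ⟨Real.sqrt r * C * (s : ℂ)⁻¹ * chirpGaussSum a b 0 * w / (s : ℂ) ^ (-(1/2) : ℂ),
    div_ne_zero (mul_ne_zero (mul_ne_zero (mul_ne_zero (mul_ne_zero hrr hC0) (inv_ne_zero hs'))
      (chirpGaussSum_zero_ne_zero hb hdet)) (Complex.exp_ne_zero _)) hsr, fun f => ?_⟩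
  rw [div_mul_cancel₀ _ hsr, frftCombPair]
  simp_rw [frFT_eq_chirpFourier f hr.ne' hs.ne' hb hcos hsin, ← hC]
  have h := tsum_exp_mul_chirpFourier f (a / (b * r ^ 2)) hs a hb
  simp only [Complex.ofReal_intCast]
  rw [tsum_mul_left, h]
  simp only [mul_assoc]
  congr 3
  rw [← tsum_mul_left, ← tsum_mul_left]
  refine tsum_congr fun k => ?_
  rw [chirpGaussSum_eq hb hdet, mul_assoc]
  congr 1
  simp only [hw, ← mul_assoc (Complex.exp _), ← Complex.exp_add]
  congr 2
  have hq : (a / (b * r ^ 2) : ℂ) = d * s ^ 2 / b - t := by rw [← hphase]; ring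
  push_cast
  rw [hq]
  field_simp
  ring
end

section
/- Let M = (a b; c d) be a real 2×2 matrix with ad − bc = 1 and let q, p ∈ ℝ. Suppose there exists μ ∈ ℂ with μ ≠ 0 such that for every Schwartz function f : ℝ → ℂ, ⟨S_{(q/2,p/2)}𝓜(M)Ш₁, f⟩ = μ·∑_{n∈ℤ} f(n). Then a, b, c, d are all integers, and q − ab and p − cd are even integers. -/
open MeasureTheory

/-- The metaplectic operator `𝓜(M)` associated with a real matrix `M = (a b; c d)` with
`ad - bc = 1`, acting on functions `f : ℝ → ℂ`.  Square roots with positive real part are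
given by the principal complex power. -/
noncomputable def metaplectic (a b c d : ℝ) (f : ℝ → ℂ) (x : ℝ) : ℂ :=
  if b ≠ 0 then
    (Complex.I * (b : ℂ)) ^ (-(1/2) : ℂ) *
      ∫ y : ℝ, Complex.exp ((Real.pi : ℂ) * Complex.I / (b : ℂ) *
        ((d * x ^ 2 - 2 * x * y + a * y ^ 2 : ℝ) : ℂ)) * f y
  else if 0 < a then
    (a : ℂ) ^ (-(1/2) : ℂ) * Complex.exp ((Real.pi : ℂ) * Complex.I * ((c / a : ℝ) : ℂ)
      * ((x : ℂ)) ^ 2) * f (x / a)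
  else
    -Complex.I * ((-a : ℝ) : ℂ) ^ (-(1/2) : ℂ) *
      Complex.exp ((Real.pi : ℂ) * Complex.I * ((c / a : ℝ) : ℂ) * ((x : ℂ)) ^ 2) * f (x / a)

/-- The pairing `⟨S_{(q/2,p/2)} 𝓜(M) Ш₁, f⟩ = ∑_{n ∈ ℤ} (𝓜(M') g)(n)` where
`M' = (d b; c a)` and `g(x) = exp(πiqp/4 + πipx) f(x + q/2)`. -/
noncomputable def shiftMetaPair (a b c d q p : ℝ) (f : ℝ → ℂ) : ℂ :=
  ∑' n : ℤ, metaplectic d b c a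
    (fun x => Complex.exp ((Real.pi : ℂ) * Complex.I * (q : ℂ) * (p : ℂ) / 4
        + (Real.pi : ℂ) * Complex.I * (p : ℂ) * (x : ℂ)) * f (x + q / 2)) (n : ℝ)

/-- The pairing is quasi-invariant under the phase-space shift by `(b, -d)`. -/
lemma shiftMetaPair_shift_second_column (a b c d q p : ℝ) (hdet : a * d - b * c = 1)
    (f : ℝ → ℂ) :
    shiftMetaPair a b c d q p
      (fun y => Complex.exp (2 * Real.pi * Complex.I * ((-d : ℝ) : ℂ) * y) * f (y - b)) =
    Complex.exp (Real.pi * Complex.I * ((p * b - b * d - d * q : ℝ) : ℂ)) *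
      shiftMetaPair a b c d q p f := by
  unfold shiftMetaPair
  rw [← tsum_mul_left]
  refine tsum_congr fun n => ?_
  unfold metaplectic
  by_cases hb : b = 0
  · subst hb
    have hd : d ≠ 0 := by rintro rfl; simp at hdet
    have hd' : (d : ℂ) ≠ 0 := by exact_mod_cast hd
    have key : Complex.exp (2 * Real.pi * Complex.I * ((-d : ℝ) : ℂ) * ((n / d + q / 2 : ℝ) : ℂ)) =
        Complex.exp (Real.pi * Complex.I * ((p * 0 - 0 * d - d * q : ℝ) : ℂ)) := by
      rw [Complex.exp_eq_exp_iff_exists_int]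
      refine ⟨-n, ?_⟩
      push_cast
      field_simp
      ring
    simp only [ne_eq, not_true_eq_false, if_false, sub_zero] at key ⊢
    rw [key]
    split_ifs <;> ring
  · have hb' : (b : ℂ) ≠ 0 := by exact_mod_cast hb
    simp only [ne_eq, hb, not_false_eq_true, if_true]
    rw [mul_left_comm, ← integral_const_mul (Complex.exp _)]
    congr 1
    rw [← integral_add_right_eq_self _ b]
    refine integral_congr_ae (.of_forall fun y => ?_)
    beta_reduce
    rw [show y + b + q / 2 - b = y + q / 2 by ring]
    simp only [← mul_assoc, ← Complex.exp_add]
    congr 1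
    rw [Complex.exp_eq_exp_iff_exists_int]
    refine ⟨-n, ?_⟩
    push_cast
    field_simp
    ring

/-- The pairing is quasi-invariant under the phase-space shift by `(a, -c)`. -/
lemma shiftMetaPair_shift_first_column (a b c d q p : ℝ) (hdet : a * d - b * c = 1)
    (f : ℝ → ℂ) :
    shiftMetaPair a b c d q p
      (fun y => Complex.exp (2 * Real.pi * Complex.I * ((-c : ℝ) : ℂ) * y) * f (y - a)) =
    Complex.exp (Real.pi * Complex.I * ((p * a - a * c - c * q : ℝ) : ℂ)) *
      shiftMetaPair a b c d q p f := by
  unfold shiftMetaPair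
  rw [← tsum_mul_left, ← (Equiv.addRight (1 : ℤ)).tsum_eq]
  refine tsum_congr fun n => ?_
  unfold metaplectic
  simp only [Equiv.coe_addRight]
  by_cases hb : b = 0
  · subst hb
    have hd : d ≠ 0 := by rintro rfl; simp at hdet
    have hd' : (d : ℂ) ≠ 0 := by exact_mod_cast hd
    obtain rfl : a = 1 / d := by field_simp; linarith
    rw [show ((n + 1 : ℤ) : ℝ) / d + q / 2 - 1 / d = n / d + q / 2 by push_cast; ring]
    simp only [ne_eq, not_true_eq_false, if_false]
    have key : Complex.exp (Real.pi * Complex.I * ((c / d : ℝ) : ℂ) *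
          (((n + 1 : ℤ) : ℝ) : ℂ) ^ 2) *
        Complex.exp (Real.pi * Complex.I * q * p / 4 +
          Real.pi * Complex.I * p * ((((n + 1 : ℤ) : ℝ) / d : ℝ) : ℂ)) *
        Complex.exp (2 * Real.pi * Complex.I * ((-c : ℝ) : ℂ) *
          ((((n + 1 : ℤ) : ℝ) / d + q / 2 : ℝ) : ℂ)) =
        Complex.exp (Real.pi * Complex.I * ((p * (1 / d) - 1 / d * c - c * q : ℝ) : ℂ)) *
        Complex.exp (Real.pi * Complex.I * ((c / d : ℝ) : ℂ) * ((n : ℝ) : ℂ) ^ 2) *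
        Complex.exp (Real.pi * Complex.I * q * p / 4 +
          Real.pi * Complex.I * p * ((n / d : ℝ) : ℂ)) := by
      simp only [← Complex.exp_add]
      congr 1
      push_cast
      field_simp
      ring
    split_ifs
    · linear_combination (d : ℂ) ^ (-(1 / 2) : ℂ) * f (n / d + q / 2) * key
    · linear_combination
        -Complex.I * ((-d : ℝ) : ℂ) ^ (-(1 / 2) : ℂ) * f (n / d + q / 2) * key
  · have hb' : (b : ℂ) ≠ 0 := by exact_mod_cast hb
    obtain rfl : c = (a * d - 1) / b := by field_simp; linarith
    simp only [ne_eq, hb, not_false_eq_true, if_true]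
    rw [mul_left_comm, ← integral_const_mul (Complex.exp _)]
    congr 1
    rw [← integral_add_right_eq_self _ a]
    refine integral_congr_ae (.of_forall fun y => ?_)
    beta_reduce
    rw [show y + a + q / 2 - a = y + q / 2 by ring]
    simp only [← mul_assoc, ← Complex.exp_add]
    congr 2
    push_cast
    field_simp
    ring

/-- There is a smooth compactly supported function equal to `1` at `x` and vanishing outside the
`ε`-neighbourhood of `x`. -/
lemma exists_smooth_bump_at (x ε : ℝ) (hε : 0 < ε) :
    ∃ f : ℝ → ℂ, ContDiff ℝ (⊤ : ℕ∞) f ∧ HasCompactSupport f ∧ f x = 1 ∧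
      ∀ y, ε ≤ |y - x| → f y = 0 := by
  let g : ContDiffBump x := ⟨ε / 2, ε, by positivity, by linarith⟩
  refine ⟨fun y => (g y : ℂ), Complex.ofRealCLM.contDiff.comp g.contDiff,
    g.hasCompactSupport.comp_left (g := Complex.ofReal) rfl, ?_, fun y hy => ?_⟩
  · simp [g.one_of_mem_closedBall (Metric.mem_closedBall_self g.rIn_pos.le)]
  · have : g y = 0 := g.zero_of_le_dist (by simpa [Real.dist_eq] using hy)
    simp [this]

/-- If the Dirac comb is an eigenvector of a time-frequency shift, then the shift is by integers
and the eigenvalue is `1`. -/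
lemma int_of_comb_shift_eigenvector (x₀ ξ : ℝ) (κ : ℂ) (hκ : κ ≠ 0)
    (h : ∀ f : ℝ → ℂ, ContDiff ℝ (⊤ : ℕ∞) f → HasCompactSupport f →
      ∑' n : ℤ, Complex.exp (2 * Real.pi * Complex.I * (ξ : ℂ) * ((n : ℝ) : ℂ)) *
        f ((n : ℝ) - x₀) = κ * ∑' n : ℤ, f n) :
    (∃ k : ℤ, x₀ = k) ∧ (∃ k : ℤ, ξ = k) ∧ κ = 1 := by
  have hsum : ∀ (m : ℤ) (f : ℝ → ℂ), f m = 1 → (∀ n : ℤ, n ≠ m → f n = 0) →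
      ∑' n : ℤ, f n = 1 := fun m f h1 h0 => by
    rw [tsum_eq_single m h0, h1]
  have hint : ∀ m n : ℤ, n ≠ m → (1 : ℝ) ≤ |(n : ℝ) - m| := fun m n hn => by
    exact_mod_cast Int.one_le_abs (sub_ne_zero.mpr hn)
  obtain ⟨k, rfl⟩ : ∃ k : ℤ, x₀ = k := by
    by_contra! hx
    have hpos : 0 < |x₀ - round x₀| := abs_pos.mpr (sub_ne_zero.mpr (hx _))
    have hle := abs_sub_round x₀
    obtain ⟨f, hf, hfc, hf1, hf0⟩ := exists_smooth_bump_at ((0 : ℤ) : ℝ) _ hpos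
    have := h f hf hfc
    rw [hsum 0 f hf1 fun n hn => hf0 _ (by linarith [hint 0 n hn])] at this
    apply hκ
    rw [← mul_one κ, ← this]
    refine (tsum_congr fun n => ?_).trans tsum_zero
    rw [hf0, mul_zero]
    rw [Int.cast_zero, sub_zero, abs_sub_comm (n : ℝ)]
    exact round_le x₀ n
  have hval : ∀ m : ℤ,
      Complex.exp (2 * Real.pi * Complex.I * (ξ : ℂ) * (((m + k : ℤ) : ℝ) : ℂ)) = κ := fun m => by
    obtain ⟨f, hf, hfc, hf1, hf0⟩ := exists_smooth_bump_at (m : ℝ) 1 one_pos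
    have := h f hf hfc
    rw [hsum m f hf1 fun n hn => hf0 _ (hint m n hn), mul_one, tsum_eq_single (m + k)] at this
    · rw [← this, show ((m + k : ℤ) : ℝ) - k = m by push_cast; ring, hf1, mul_one]
    · intro n hn
      have := hint m (n - k) (by omega)
      push_cast at this
      rw [hf0 _ this, mul_zero]
  have h0 : κ = 1 := by
    rw [← hval (-k)]
    simp
  refine ⟨⟨k, rfl⟩, ?_, h0⟩
  have h1 := hval (1 - k)
  rw [h0, Complex.exp_eq_one_iff] at h1
  obtain ⟨j, hj⟩ := h1
  refine ⟨j, ?_⟩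
  have hpi : (2 * Real.pi * Complex.I : ℂ) ≠ 0 := Complex.two_pi_I_ne_zero
  have : (ξ : ℂ) = ((j : ℝ) : ℂ) := by
    apply mul_left_cancel₀ hpi
    push_cast at hj ⊢
    linear_combination hj
  exact_mod_cast this

/-- A real number `r` with `exp (π i r) = 1` is an even integer. -/
lemma exists_eq_two_mul_of_exp_pi_mul_I_eq_one (r : ℝ)
    (h : Complex.exp (Real.pi * Complex.I * (r : ℂ)) = 1) : ∃ m : ℤ, r = 2 * m := by
  rw [Complex.exp_eq_one_iff] at h
  obtain ⟨j, hj⟩ := h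
  refine ⟨j, ?_⟩
  have hpi : (Real.pi * Complex.I : ℂ) ≠ 0 :=
    mul_ne_zero (by exact_mod_cast Real.pi_ne_zero) Complex.I_ne_zero
  have : (r : ℂ) = ((2 * j : ℝ) : ℂ) := by
    apply mul_left_cancel₀ hpi
    push_cast
    linear_combination hj
  exact_mod_cast this

/-- If the Dirac comb is an eigenfunction of a shifted metaplectic operator with nonzero
eigenvalue, then the matrix has integer entries and `(q, p) ≡ (ab, cd) (mod 2)`. -/
theorem stmt4 (a b c d q p : ℝ) (hdet : a * d - b * c = 1)
    (h : ∃ μ : ℂ, μ ≠ 0 ∧ ∀ f : SchwartzMap ℝ ℂ,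
      shiftMetaPair a b c d q p (⇑f) = μ * ∑' n : ℤ, f (n : ℝ)) :
    (∃ a' : ℤ, a = (a' : ℝ)) ∧ (∃ b' : ℤ, b = (b' : ℝ)) ∧
    (∃ c' : ℤ, c = (c' : ℝ)) ∧ (∃ d' : ℤ, d = (d' : ℝ)) ∧
    (∃ m : ℤ, q - a * b = 2 * (m : ℝ)) ∧ (∃ m : ℤ, p - c * d = 2 * (m : ℝ)) := by
  obtain ⟨μ, hμ, h⟩ := h
  have hpair : ∀ f : ℝ → ℂ, ContDiff ℝ (⊤ : ℕ∞) f → HasCompactSupport f →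
      shiftMetaPair a b c d q p f = μ * ∑' n : ℤ, f n :=
    fun f hf hfc => h (hfc.toSchwartzMap hf)
  have hshift : ∀ (x₀ ξ : ℝ) (κ : ℂ), (∀ f : ℝ → ℂ, shiftMetaPair a b c d q p
      (fun y => Complex.exp (2 * Real.pi * Complex.I * (ξ : ℂ) * y) * f (y - x₀)) =
        κ * shiftMetaPair a b c d q p f) →
      ∀ f : ℝ → ℂ, ContDiff ℝ (⊤ : ℕ∞) f → HasCompactSupport f →
      ∑' n : ℤ, Complex.exp (2 * Real.pi * Complex.I * (ξ : ℂ) * ((n : ℝ) : ℂ)) *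
        f ((n : ℝ) - x₀) = κ * ∑' n : ℤ, f n := by
    intro x₀ ξ κ hκ f hf hfc
    have h1 := hκ f
    rw [hpair f hf hfc, hpair] at h1
    · exact mul_left_cancel₀ hμ (h1.trans (mul_left_comm _ _ _))
    · have h2 : ContDiff ℝ (⊤ : ℕ∞) fun y : ℝ => (y : ℂ) := Complex.ofRealCLM.contDiff
      exact (contDiff_const.mul h2).cexp.mul (hf.comp (contDiff_id.sub contDiff_const))
    · exact (hfc.comp_homeomorph (Homeomorph.subRight x₀)).mul_left
  obtain ⟨⟨b', rfl⟩, ⟨d', hd⟩, h1⟩ := int_of_comb_shift_eigenvector _ _ _ (Complex.exp_ne_zero _)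
    (hshift _ _ _ (shiftMetaPair_shift_second_column a b c d q p hdet))
  obtain ⟨⟨a', rfl⟩, ⟨c', hc⟩, h2⟩ := int_of_comb_shift_eigenvector _ _ _ (Complex.exp_ne_zero _)
    (hshift _ _ _ (shiftMetaPair_shift_first_column a _ c d q p hdet))
  obtain ⟨m, hm⟩ := exists_eq_two_mul_of_exp_pi_mul_I_eq_one _ h1
  obtain ⟨l, hl⟩ := exists_eq_two_mul_of_exp_pi_mul_I_eq_one _ h2
  obtain ⟨d', rfl⟩ : ∃ k : ℤ, d = k := ⟨-d', by push_cast; linarith⟩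
  obtain ⟨c', rfl⟩ : ∃ k : ℤ, c = k := ⟨-c', by push_cast; linarith⟩
  have hdet' : a' * d' - b' * c' = 1 := by exact_mod_cast hdet
  have hparity : ∀ x y z w : ℤ, x * w - y * z = 1 → Even (x * y * (z - w - 1)) := by
    intro x y z w hxy
    have := congrArg Even hxy
    simp only [Int.even_sub, Int.even_mul, Int.not_even_one, eq_iff_iff, iff_false] at this ⊢
    tauto
  obtain ⟨s, hs⟩ := hparity a' b' c' d' hdet'
  obtain ⟨t, ht⟩ := hparity d' c' b' a' (by linarith)
  refine ⟨⟨a', rfl⟩, ⟨b', rfl⟩, ⟨c', rfl⟩, ⟨d', rfl⟩, ⟨b' * l - a' * m + s, ?_⟩,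
    ⟨d' * l - c' * m - t - c' * d', ?_⟩⟩
  · have hs' : (a' * b' * (c' - d' - 1) : ℝ) = s + s := by exact_mod_cast hs
    push_cast
    linear_combination (-q) * hdet + b' * hl - a' * hm + hs'
  · have ht' : (d' * c' * (b' - a' - 1) : ℝ) = t + t := by exact_mod_cast ht
    push_cast
    linear_combination (-p) * hdet + d' * hl - c' * hm - ht'
end

section
/- Let M = (a b; c d) be a 2×2 integer matrix with ad − bc = 1, and let q, p ∈ ℤ with q ≡ ab (mod 2) and p ≡ cd (mod 2). Then there exists μ ∈ ℂ with μ⁸ = 1 such that for all z ∈ ℂ and all τ ∈ ℂ with Im τ > 0, writing z' = z/(a + bτ) and τ' = (c + dτ)/(a + bτ): θ₀₀(z, τ) = μ^(−1)·exp(−πi·b·z²/(a + bτ))·(a + bτ)^(−1/2)·θ_{qp}(z', τ'), where the complex square root is taken with positive real part. -/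
/-- The Jacobi theta function with half-integer characteristics:
`θ_{qp}(z, τ) = ∑_{n∈ℤ} exp(-πiqp/4 + πipn + 2πiz(n - q/2) + πiτ(n - q/2)²)`. -/
noncomputable def jacobiThetaQP (q p : ℤ) (z τ : ℂ) : ℂ :=
  ∑' n : ℤ, Complex.exp (
    -(Real.pi : ℂ) * Complex.I * (q : ℂ) * (p : ℂ) / 4
    + (Real.pi : ℂ) * Complex.I * (p : ℂ) * (n : ℂ)
    + 2 * (Real.pi : ℂ) * Complex.I * z * ((n : ℂ) - (q : ℂ) / 2)
    + (Real.pi : ℂ) * Complex.I * τ * ((n : ℂ) - (q : ℂ) / 2) ^ 2)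

open Complex in
theorem jacobiThetaQP_eq_jacobiTheta₂ (q p : ℤ) (z τ : ℂ) :
    jacobiThetaQP q p z τ =
      cexp (-(Real.pi : ℂ) * I * q * p / 4 - Real.pi * I * q * z + Real.pi * I * τ * q ^ 2 / 4) *
        jacobiTheta₂ (z + p / 2 - q * τ / 2) τ := by
  rw [jacobiThetaQP, jacobiTheta₂, ← tsum_mul_left]
  refine tsum_congr fun n => ?_
  rw [jacobiTheta₂_term, ← Complex.exp_add]
  congr 1
  ring

open Complex in
theorem exp_pi_mul_I_mul_int_div_four_pow_eight (k : ℤ) :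
    cexp ((Real.pi : ℂ) * I * k / 4) ^ 8 = 1 := by
  rw [← Complex.exp_nat_mul, ← Complex.exp_int_mul_two_pi_mul_I k]
  congr 1
  push_cast
  ring

open Complex in
/-- Characteristics that are both even can be removed up to an eighth root of unity. -/
theorem jacobiThetaQP_even_even (k m : ℤ) :
    ∃ μ : ℂ, μ ^ 8 = 1 ∧ ∀ z τ : ℂ,
      jacobiThetaQP (2 * k) (2 * m) z τ = μ * jacobiThetaQP 0 0 z τ := by
  refine ⟨_, exp_pi_mul_I_mul_int_div_four_pow_eight (-4 * k * m), fun z τ => ?_⟩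
  rw [jacobiThetaQP, jacobiThetaQP, ← tsum_mul_left, ← (Equiv.addRight k).tsum_eq]
  refine tsum_congr fun n => ?_
  rw [← Complex.exp_add, Complex.exp_eq_exp_iff_exists_int]
  refine ⟨m * (n + k), ?_⟩
  simp only [Equiv.coe_addRight]
  push_cast
  ring

open Complex in
/-- The behaviour of the theta functions with characteristics under `τ ↦ τ + 1`. -/
theorem jacobiThetaQP_add_one (q p : ℤ) :
    ∃ μ : ℂ, μ ^ 8 = 1 ∧ ∀ z τ : ℂ,
      jacobiThetaQP q p z (τ + 1) = μ * jacobiThetaQP q (p + 1 - q) z τ := by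
  refine ⟨_, exp_pi_mul_I_mul_int_div_four_pow_eight q, fun z τ => ?_⟩
  rw [jacobiThetaQP, jacobiThetaQP, ← tsum_mul_left]
  refine tsum_congr fun n => ?_
  obtain ⟨r, hr⟩ := (Int.even_mul_pred_self n).two_dvd
  have hr' : (n : ℂ) ^ 2 = n + 2 * r := by
    have : n ^ 2 = n + 2 * r := by linarith
    exact_mod_cast this
  rw [← Complex.exp_add, Complex.exp_eq_exp_iff_exists_int]
  refine ⟨r, ?_⟩
  push_cast
  linear_combination (Real.pi : ℂ) * I * hr'

open Complex in
/-- The behaviour of the theta functions with characteristics under `τ ↦ -1 / τ`. -/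
theorem jacobiThetaQP_neg_one_div (q p : ℤ) (z τ : ℂ) (hτ : τ ≠ 0) :
    jacobiThetaQP q p z τ =
      1 / (-I * τ) ^ (1 / 2 : ℂ) * cexp (-(Real.pi : ℂ) * I * z ^ 2 / τ) *
        jacobiThetaQP p (-q) (z / τ) (-1 / τ) := by
  rw [jacobiThetaQP_eq_jacobiTheta₂, jacobiThetaQP_eq_jacobiTheta₂,
    jacobiTheta₂_functional_equation]
  have harg : (z + p / 2 - q * τ / 2) / τ = z / τ + ((-q : ℤ) : ℂ) / 2 - p * (-1 / τ) / 2 := by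
    push_cast
    field_simp
    ring
  rw [harg]
  have hexp : cexp (-(Real.pi : ℂ) * I * q * p / 4 - Real.pi * I * q * z
        + Real.pi * I * τ * q ^ 2 / 4) *
      cexp (-Real.pi * I * (z + p / 2 - q * τ / 2) ^ 2 / τ) =
      cexp (-(Real.pi : ℂ) * I * z ^ 2 / τ) *
      cexp (-(Real.pi : ℂ) * I * p * (-q : ℤ) / 4 - Real.pi * I * p * (z / τ)
        + Real.pi * I * (-1 / τ) * p ^ 2 / 4) := by
    rw [← Complex.exp_add, ← Complex.exp_add]
    congr 1
    push_cast
    field_simp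
    ring
  linear_combination (1 / (-I * τ) ^ (1 / 2 : ℂ) * jacobiTheta₂ (z / τ + ((-q : ℤ) : ℂ) / 2
    - p * (-1 / τ) / 2) (-1 / τ)) * hexp

theorem add_mul_ne_zero_of_im_pos {a b : ℤ} (hab : a ≠ 0 ∨ b ≠ 0) {τ : ℂ} (hτ : 0 < τ.im) :
    (a : ℂ) + b * τ ≠ 0 := by
  intro h
  have him := congrArg Complex.im h
  have hre := congrArg Complex.re h
  simp at him hre
  have hb : b = 0 := him.resolve_right hτ.ne'
  subst hb
  simp at hre
  exact hab.elim (fun h => h hre) (fun h => h rfl)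

theorem im_div_pos_of_det_eq_one {a b c d : ℤ} (hdet : a * d - b * c = 1) {τ : ℂ}
    (hτ : 0 < τ.im) (h0 : (a : ℂ) + b * τ ≠ 0) :
    0 < (((c : ℂ) + d * τ) / (a + b * τ)).im := by
  have hdet' : (a : ℝ) * d - b * c = 1 := by exact_mod_cast hdet
  have hn : 0 < Complex.normSq ((a : ℂ) + b * τ) := Complex.normSq_pos.mpr h0
  rw [Complex.div_im, ← sub_div]
  refine div_pos ?_ hn
  simp
  nlinarith [hdet', hτ]

theorem continuousOn_add_mul_cpow (a b : ℤ) (s : ℂ) :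
    ContinuousOn (fun τ : ℂ => ((a : ℂ) + b * τ) ^ s) {τ : ℂ | 0 < τ.im} := by
  rcases eq_or_ne b 0 with rfl | hb
  · simpa using continuousOn_const
  · refine ContinuousOn.cpow_const (by fun_prop) fun τ hτ => ?_
    have hτ' : 0 < τ.im := hτ
    exact Complex.mem_slitPlane_iff.mpr (Or.inr (by simp [hb, hτ'.ne']))

theorem cpow_neg_half_sq (x : ℂ) : (x ^ (-(1 / 2) : ℂ)) ^ 2 = x⁻¹ := by
  rw [← Complex.cpow_nat_mul, ← Complex.cpow_neg_one]
  norm_num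

open Complex in
/-- The square roots of the automorphy factors satisfy the cocycle relation up to a constant
eighth root of unity. -/
theorem cpow_neg_half_cocycle {a b c d : ℤ} (hdet : a * d - b * c = 1) :
    ∃ ε : ℂ, ε ^ 8 = 1 ∧ ∀ τ : ℂ, 0 < τ.im →
      ((a : ℂ) + b * τ) ^ (-(1 / 2) : ℂ) *
          (1 / (-I * (((c : ℂ) + d * τ) / (a + b * τ))) ^ (1 / 2 : ℂ)) =
        ε * ((c : ℂ) + d * τ) ^ (-(1 / 2) : ℂ) := by
  have hab : a ≠ 0 ∨ b ≠ 0 := by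
    by_contra! h
    simp [h] at hdet
  have hcd : c ≠ 0 ∨ d ≠ 0 := by
    by_contra! h
    simp [h] at hdet
  have hI8 : cexp ((Real.pi : ℂ) * I / 4) ^ 8 = 1 := by
    simpa using exp_pi_mul_I_mul_int_div_four_pow_eight 1
  have hI2 : cexp ((Real.pi : ℂ) * I / 4) ^ 2 = I := by
    rw [← Complex.exp_nat_mul]
    convert Complex.exp_pi_div_two_mul_I using 2
    push_cast
    ring
  have hpre : IsPreconnected {τ : ℂ | 0 < τ.im} := (convex_halfSpace_im_gt 0).isPreconnected
  have hcont : ContinuousOn (fun τ : ℂ => ((a : ℂ) + b * τ) ^ (-(1 / 2) : ℂ) *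
      (-I * (((c : ℂ) + d * τ) / (a + b * τ))) ^ (-(1 / 2) : ℂ)) {τ : ℂ | 0 < τ.im} := by
    refine (continuousOn_add_mul_cpow a b _).mul (ContinuousOn.cpow_const ?_ fun τ hτ => ?_)
    · exact continuousOn_const.mul (ContinuousOn.div (by fun_prop) (by fun_prop)
        fun τ hτ => add_mul_ne_zero_of_im_pos hab hτ)
    · refine Complex.mem_slitPlane_iff.mpr (Or.inl ?_)
      simpa using im_div_pos_of_det_eq_one hdet hτ (add_mul_ne_zero_of_im_pos hab hτ)
  have hsq : Set.EqOn ((fun τ : ℂ => ((a : ℂ) + b * τ) ^ (-(1 / 2) : ℂ) *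
      (-I * (((c : ℂ) + d * τ) / (a + b * τ))) ^ (-(1 / 2) : ℂ)) ^ 2)
      ((fun τ : ℂ => cexp ((Real.pi : ℂ) * I / 4) * ((c : ℂ) + d * τ) ^ (-(1 / 2) : ℂ)) ^ 2)
      {τ : ℂ | 0 < τ.im} := by
    intro τ hτ
    have h1 := add_mul_ne_zero_of_im_pos hab hτ
    have h2 := add_mul_ne_zero_of_im_pos hcd hτ
    simp only [Pi.pow_apply, mul_pow]
    rw [cpow_neg_half_sq, cpow_neg_half_sq, cpow_neg_half_sq, hI2]
    rw [mul_inv, inv_div, inv_neg, Complex.inv_I, neg_neg]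
    field_simp
  have hinv : ∀ x : ℂ, 1 / x ^ (1 / 2 : ℂ) = x ^ (-(1 / 2) : ℂ) := fun x => by
    rw [Complex.cpow_neg, one_div]
  simp_rw [hinv]
  rcases hpre.eq_or_eq_neg_of_sq_eq hcont
    (continuousOn_const.mul (continuousOn_add_mul_cpow c d _)) hsq (fun {τ} hτ =>
      mul_ne_zero (Complex.exp_ne_zero _)
        ((Complex.cpow_ne_zero_iff_of_exponent_ne_zero (by norm_num)).mpr
          (add_mul_ne_zero_of_im_pos hcd hτ))) with h | h
  · exact ⟨_, hI8, fun τ hτ => h hτ⟩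
  · refine ⟨-cexp ((Real.pi : ℂ) * I / 4), by rw [Even.neg_pow (by decide), hI8], fun τ hτ => ?_⟩
    exact (h hτ).trans (neg_mul _ _).symm

/-- The transformation law of `θ₀₀` under the integer matrix with rows `(a, b)` and `(c, d)`. -/
def ThetaTransforms (a b c d : ℤ) : Prop :=
  ∀ q p : ℤ, q ≡ a * b [ZMOD 2] → p ≡ c * d [ZMOD 2] →
    ∃ μ : ℂ, μ ^ 8 = 1 ∧ ∀ z τ : ℂ, 0 < τ.im →
      jacobiThetaQP 0 0 z τ
        = μ⁻¹ * Complex.exp (-(Real.pi : ℂ) * Complex.I * (b : ℂ) * z ^ 2 / ((a : ℂ) + (b : ℂ) * τ)) *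
          ((a : ℂ) + (b : ℂ) * τ) ^ (-(1/2) : ℂ) *
          jacobiThetaQP q p (z / ((a : ℂ) + (b : ℂ) * τ))
            (((c : ℂ) + (d : ℂ) * τ) / ((a : ℂ) + (b : ℂ) * τ))

theorem thetaTransforms_one : ThetaTransforms 1 0 0 1 := by
  intro q p hq hp
  obtain ⟨k, rfl⟩ : (2 : ℤ) ∣ q := Int.modEq_zero_iff_dvd.mp (by simpa using hq)
  obtain ⟨m, rfl⟩ : (2 : ℤ) ∣ p := Int.modEq_zero_iff_dvd.mp (by simpa using hp)
  obtain ⟨μ, hμ, h⟩ := jacobiThetaQP_even_even k m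
  have hμ0 : μ ≠ 0 := by
    rintro rfl
    simp at hμ
  refine ⟨μ, hμ, fun z τ _ => ?_⟩
  simp [h, hμ0]

theorem ThetaTransforms.T_mul {a b c d : ℤ} (hdet : a * d - b * c = 1)
    (h : ThetaTransforms a b c d) : ThetaTransforms a b (c + a) (d + b) := by
  intro q p hq hp
  have hab : a ≠ 0 ∨ b ≠ 0 := by
    by_contra! h
    simp [h] at hdet
  have hp' : p + 1 - q ≡ c * d [ZMOD 2] := by
    have h1 : c * d = (c + a) * (d + b) + 1 - a * b - 2 * (b * c + 1) := by linear_combination -hdet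
    have h2 := ((hp.add_right 1).sub hq).sub_right (2 * (b * c + 1))
    rw [h1]
    refine Int.ModEq.trans ?_ h2
    exact (Int.modEq_iff_dvd.mpr ⟨-(b * c + 1), by ring⟩)
  obtain ⟨μ, hμ, hT⟩ := jacobiThetaQP_add_one q p
  obtain ⟨ν, hν, hM⟩ := h q (p + 1 - q) hq hp'
  have hμ0 : μ ≠ 0 := by
    rintro rfl
    simp at hμ
  refine ⟨ν * μ, by rw [mul_pow, hμ, hν, one_mul], fun z τ hτ => ?_⟩
  have h0 := add_mul_ne_zero_of_im_pos hab hτ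
  have hτ' : (((c + a : ℤ) : ℂ) + ((d + b : ℤ) : ℂ) * τ) / ((a : ℂ) + b * τ) =
      ((c : ℂ) + d * τ) / (a + b * τ) + 1 := by
    rw [div_add_one h0]
    push_cast
    ring
  rw [hM z τ hτ, hτ', hT, mul_inv]
  linear_combination (-(ν⁻¹ * Complex.exp (-(Real.pi : ℂ) * Complex.I * b * z ^ 2 / (a + b * τ)) *
    ((a : ℂ) + b * τ) ^ (-(1 / 2) : ℂ) * jacobiThetaQP q (p + 1 - q) (z / (a + b * τ))
      ((c + d * τ) / (a + b * τ)))) * inv_mul_cancel₀ hμ0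

theorem ThetaTransforms.T_inv_mul {a b c d : ℤ} (hdet : a * d - b * c = 1)
    (h : ThetaTransforms a b c d) : ThetaTransforms a b (c - a) (d - b) := by
  intro q p hq hp
  have hab : a ≠ 0 ∨ b ≠ 0 := by
    by_contra! h
    simp [h] at hdet
  have hp' : p - 1 + q ≡ c * d [ZMOD 2] := by
    have h1 : c * d = (c - a) * (d - b) - 1 + a * b + 2 * (b * c + 1 - a * b) := by
      linear_combination hdet
    have h2 := ((hp.sub_right 1).add hq).add_right (2 * (b * c + 1 - a * b))
    rw [h1]
    refine Int.ModEq.trans ?_ h2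
    exact (Int.modEq_iff_dvd.mpr ⟨b * c + 1 - a * b, by ring⟩)
  obtain ⟨μ, hμ, hT⟩ := jacobiThetaQP_add_one q (p - 1 + q)
  obtain ⟨ν, hν, hM⟩ := h q (p - 1 + q) hq hp'
  have hμ0 : μ ≠ 0 := by
    rintro rfl
    simp at hμ
  refine ⟨ν * μ⁻¹, by rw [mul_pow, inv_pow, hμ, hν, inv_one, one_mul], fun z τ hτ => ?_⟩
  have h0 := add_mul_ne_zero_of_im_pos hab hτ
  have hτ' : ((c : ℂ) + d * τ) / (a + b * τ) =
      (((c - a : ℤ) : ℂ) + ((d - b : ℤ) : ℂ) * τ) / ((a : ℂ) + b * τ) + 1 := by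
    rw [div_add_one h0]
    push_cast
    ring
  rw [hM z τ hτ, hτ', hT, mul_inv, inv_inv, show p - 1 + q + 1 - q = p by ring]
  ring

theorem ThetaTransforms.S_inv_mul {a b c d : ℤ} (hdet : a * d - b * c = 1)
    (h : ThetaTransforms a b c d) : ThetaTransforms c d (-a) (-b) := by
  intro q p hq hp
  have hab : a ≠ 0 ∨ b ≠ 0 := by
    by_contra! h
    simp [h] at hdet
  have hcd : c ≠ 0 ∨ d ≠ 0 := by
    by_contra! h
    simp [h] at hdet
  have hp' : -p ≡ a * b [ZMOD 2] := by
    rw [neg_mul_neg] at hp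
    exact (Int.modEq_iff_dvd.mpr ⟨p, by ring⟩ : -p ≡ p [ZMOD 2]).trans hp
  obtain ⟨ε, hε, hroot⟩ := cpow_neg_half_cocycle hdet
  obtain ⟨ν, hν, hM⟩ := h (-p) q hp' hq
  refine ⟨ν * ε⁻¹, by rw [mul_pow, inv_pow, hε, hν, inv_one, one_mul], fun z τ hτ => ?_⟩
  have h1 := add_mul_ne_zero_of_im_pos hab hτ
  have h2 := add_mul_ne_zero_of_im_pos hcd hτ
  have hdet' : (a : ℂ) * d - b * c = 1 := by exact_mod_cast hdet
  have hexp : Complex.exp (-(Real.pi : ℂ) * Complex.I * d * z ^ 2 / (c + d * τ)) =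
      Complex.exp (-(Real.pi : ℂ) * Complex.I * b * z ^ 2 / (a + b * τ)) *
      Complex.exp (-(Real.pi : ℂ) * Complex.I * (z / (a + b * τ)) ^ 2 /
        ((c + d * τ) / (a + b * τ))) := by
    rw [← Complex.exp_add]
    congr 1
    have hxy : d * ((a : ℂ) + b * τ) = b * (c + d * τ) + 1 := by linear_combination hdet'
    generalize (a : ℂ) + b * τ = x at *
    generalize (c : ℂ) + d * τ = y at *
    field_simp
    linear_combination -z ^ 2 * hxy
  have hz : z / ((a : ℂ) + b * τ) / (((c : ℂ) + d * τ) / (a + b * τ)) = z / (c + d * τ) := by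
    field_simp
  have hτ' : -1 / (((c : ℂ) + d * τ) / (a + b * τ)) =
      (((-a : ℤ) : ℂ) + ((-b : ℤ) : ℂ) * τ) / (c + d * τ) := by
    push_cast
    field_simp
    ring
  rw [hM z τ hτ, jacobiThetaQP_neg_one_div _ _ _ _ (div_ne_zero h2 h1), hz, hτ', hexp, neg_neg,
    mul_inv, inv_inv]
  linear_combination (ν⁻¹ * Complex.exp (-(Real.pi : ℂ) * Complex.I * b * z ^ 2 / (a + b * τ)) *
      Complex.exp (-(Real.pi : ℂ) * Complex.I * (z / (a + b * τ)) ^ 2 /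
        ((c + d * τ) / (a + b * τ))) * jacobiThetaQP q p (z / (c + d * τ))
        ((((-a : ℤ) : ℂ) + ((-b : ℤ) : ℂ) * τ) / (c + d * τ))) * hroot τ hτ

open Matrix Matrix.SpecialLinearGroup ModularGroup MatrixGroups in
theorem thetaTransforms_SL2Z (g : SL(2, ℤ)) :
    ThetaTransforms (g 0 0) (g 0 1) (g 1 0) (g 1 1) := by
  have hg : g ∈ Subgroup.closure {S, T} := by simp [_root_.SpecialLinearGroup.SL2Z_generators]
  induction hg using Subgroup.closure_induction_left with
  | one => simpa using thetaTransforms_one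
  | mul_left x hx y _ hy =>
    have hdet := y.det_coe
    rw [Matrix.det_fin_two] at hdet
    rcases hx with rfl | rfl
    · have h := ((hy.S_inv_mul hdet).S_inv_mul (by linarith)).S_inv_mul (by linarith)
      simpa [coe_S, Matrix.mul_apply, Fin.sum_univ_two] using h
    · have h := (((hy.S_inv_mul hdet).T_inv_mul (by linarith)).S_inv_mul (by linarith)).S_inv_mul
        (by linarith) |>.S_inv_mul (by linarith)
      simpa [coe_T, Matrix.mul_apply, Fin.sum_univ_two, add_comm] using h
  | inv_mul_cancel x hx y _ hy =>
    have hdet := y.det_coe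
    rw [Matrix.det_fin_two] at hdet
    rcases hx with rfl | rfl
    · simpa [coe_S, Matrix.adjugate_fin_two, Matrix.mul_apply, Fin.sum_univ_two]
        using hy.S_inv_mul hdet
    · have h := (((hy.S_inv_mul hdet).T_mul (by linarith)).S_inv_mul (by linarith)).S_inv_mul
        (by linarith) |>.S_inv_mul (by linarith)
      simpa [coe_T, Matrix.adjugate_fin_two, Matrix.mul_apply, Fin.sum_univ_two, add_comm] using h

/-- The functional equation for Jacobi theta functions under `SL(2,ℤ)`: the coefficient is
an eighth root of unity. -/
theorem stmt5 (a b c d q p : ℤ) (hdet : a * d - b * c = 1)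
    (hq : q ≡ a * b [ZMOD 2]) (hp : p ≡ c * d [ZMOD 2]) :
    ∃ μ : ℂ, μ ^ 8 = 1 ∧ ∀ z τ : ℂ, 0 < τ.im →
      jacobiThetaQP 0 0 z τ
        = μ⁻¹ * Complex.exp (-(Real.pi : ℂ) * Complex.I * (b : ℂ) * z ^ 2 / ((a : ℂ) + (b : ℂ) * τ)) *
          ((a : ℂ) + (b : ℂ) * τ) ^ (-(1/2) : ℂ) *
          jacobiThetaQP q p (z / ((a : ℂ) + (b : ℂ) * τ))
            (((c : ℂ) + (d : ℂ) * τ) / ((a : ℂ) + (b : ℂ) * τ)) :=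
  thetaTransforms_SL2Z ⟨!![a, b; c, d], by rw [Matrix.det_fin_two_of, hdet]⟩ q p hq hp
end

section
/- Let M = (a b; c d) be a 2×2 integer matrix with ad − bc = 1, let q, p ∈ ℤ with q ≡ ab (mod 2) and p ≡ cd (mod 2), and set σ = −1 if a < 0 and b ≥ 0, and σ = 1 otherwise. Let M·F₁ = (−b a; −d c), where F₁ = (0 1; −1 0) (note that (q,p) also satisfies the parity condition for M·F₁). Suppose μ₁ ∈ ℂ satisfies ⟨S_{(q/2,p/2)}𝓜(M)Ш₁, f⟩ = μ₁·∑_{n∈ℤ} f(n) for every Schwartz f, and μ₂ ∈ ℂ satisfies ⟨S_{(q/2,p/2)}𝓜(M·F₁)Ш₁, f⟩ = μ₂·∑_{n∈ℤ} f(n) for every Schwartz f. Then μ₁ = σ·exp(πi/4)·μ₂. -/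
open MeasureTheory

/-- A polynomial times a real Gaussian is bounded. -/
lemma exists_norm_eval_mul_exp_neg_sq_le (P : Polynomial ℂ) :
    ∃ C : ℝ, ∀ x : ℝ, ‖P.eval (x : ℂ)‖ * Real.exp (-Real.pi * x ^ 2) ≤ C := by
  induction P using Polynomial.induction_on' with
  | add P Q hP hQ =>
    obtain ⟨A, hA⟩ := hP
    obtain ⟨B, hB⟩ := hQ
    refine ⟨A + B, fun x => ?_⟩
    rw [Polynomial.eval_add]
    have := mul_le_mul_of_nonneg_right (norm_add_le (P.eval (x : ℂ)) (Q.eval (x : ℂ)))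
      (Real.exp_pos (-Real.pi * x ^ 2)).le
    linarith [hA x, hB x]
  | monomial n z =>
    refine ⟨‖z‖ * (n.factorial * Real.exp 1), fun x => ?_⟩
    rw [Polynomial.eval_monomial, norm_mul, norm_pow, Complex.norm_real, Real.norm_eq_abs, mul_assoc]
    refine mul_le_mul_of_nonneg_left ?_ (norm_nonneg z)
    have h1 := Real.pow_div_factorial_le_exp |x| (abs_nonneg x) n
    rw [div_le_iff₀ (by positivity)] at h1
    have h2 : Real.exp |x| * Real.exp (-Real.pi * x ^ 2) ≤ Real.exp 1 := by
      rw [← Real.exp_add, Real.exp_le_exp, ← sq_abs]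
      nlinarith [Real.pi_gt_three, sq_nonneg (|x| - 1), sq_nonneg |x|]
    calc |x| ^ n * Real.exp (-Real.pi * x ^ 2)
        ≤ Real.exp |x| * n.factorial * Real.exp (-Real.pi * x ^ 2) := by gcongr
      _ = n.factorial * (Real.exp |x| * Real.exp (-Real.pi * x ^ 2)) := by ring
      _ ≤ _ := by gcongr

/-- Every derivative of a complex Gaussian is a polynomial times that Gaussian. -/
lemma exists_iteratedDeriv_cexp_neg_sq (t : ℂ) (n : ℕ) :
    ∃ P : Polynomial ℂ, ∀ x : ℝ,
      iteratedDeriv n (fun x : ℝ => Complex.exp (-Real.pi * t * (x : ℂ) ^ 2)) x =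
        P.eval (x : ℂ) * Complex.exp (-Real.pi * t * (x : ℂ) ^ 2) := by
  induction n with
  | zero => exact ⟨1, fun x => by simp⟩
  | succ n ih =>
    obtain ⟨P, hP⟩ := ih
    refine ⟨P.derivative + P * (Polynomial.C (-Real.pi * t * 2) * Polynomial.X), fun x => ?_⟩
    rw [iteratedDeriv_succ, funext hP]
    have h1 := P.hasDerivAt (x : ℂ)
    have h2 : HasDerivAt (fun z : ℂ => Complex.exp (-Real.pi * t * z ^ 2))
        (Complex.exp (-Real.pi * t * (x : ℂ) ^ 2) * (-Real.pi * t * (2 * (x : ℂ)))) (x : ℂ) := by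
      simpa using ((hasDerivAt_pow 2 (x : ℂ)).const_mul (-Real.pi * t : ℂ)).cexp
    refine ((h1.mul h2).comp_ofReal).deriv.trans ?_
    simp only [Polynomial.eval_add, Polynomial.eval_mul, Polynomial.eval_C, Polynomial.eval_X]
    ring

/-- The complex Gaussian `exp (-π (1 + i r) x²)` as a Schwartz function. -/
noncomputable def chirpedGaussian (r : ℝ) : SchwartzMap ℝ ℂ where
  toFun x := Complex.exp (-Real.pi * (1 + r * Complex.I) * (x : ℂ) ^ 2)
  smooth' := by
    have h : ContDiff ℝ (⊤ : ℕ∞) (fun x : ℝ => (x : ℂ)) := Complex.ofRealCLM.contDiff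
    exact (contDiff_const.mul (h.pow 2)).cexp
  decay' k n := by
    obtain ⟨P, hP⟩ := exists_iteratedDeriv_cexp_neg_sq (1 + r * Complex.I) n
    obtain ⟨C, hC⟩ := exists_norm_eval_mul_exp_neg_sq_le (Polynomial.X ^ k * P)
    refine ⟨C, fun x => le_trans (le_of_eq ?_) (hC x)⟩
    rw [norm_iteratedFDeriv_eq_norm_iteratedDeriv, hP, norm_mul, Complex.norm_exp]
    have : (-Real.pi * (1 + r * Complex.I) * (x : ℂ) ^ 2).re = -Real.pi * x ^ 2 := by
      simp [← Complex.ofReal_pow]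
    rw [this, Polynomial.eval_mul, Polynomial.eval_pow, Polynomial.eval_X, norm_mul, norm_pow,
      Complex.norm_real, mul_assoc]

lemma chirpedGaussian_apply (r x : ℝ) :
    chirpedGaussian r x = Complex.exp (-Real.pi * (1 + r * Complex.I) * (x : ℂ) ^ 2) := rfl

lemma tsum_chirpedGaussian_ne_zero (r : ℝ) : ∑' n : ℤ, chirpedGaussian r (n : ℝ) ≠ 0 := by
  have him : (Complex.I - r : ℂ).im = 1 := by simp
  have h := norm_jacobiTheta_sub_one_le (τ := Complex.I - r) (by rw [him]; norm_num)
  have heq : ∑' n : ℤ, chirpedGaussian r (n : ℝ) = jacobiTheta (Complex.I - r) := by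
    rw [jacobiTheta]
    refine tsum_congr fun n => ?_
    rw [chirpedGaussian_apply]
    congr 1
    push_cast
    linear_combination (-Real.pi * n ^ 2 : ℂ) * Complex.I_sq
  rw [heq]
  intro h0
  rw [h0, him, zero_sub, norm_neg, norm_one, mul_one] at h
  have h4 : Real.exp (-Real.pi) < 1 / 4 := by
    rw [Real.exp_neg, ← one_div]
    refine one_div_lt_one_div_of_lt (by norm_num) ?_
    linarith [Real.add_one_lt_exp Real.pi_pos.ne', Real.pi_gt_three]
  rw [div_mul_eq_mul_div, le_div_iff₀ (by linarith)] at h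
  linarith

lemma metaplectic_gaussian (a b c d : ℝ) (hb : b ≠ 0) (t β γ : ℂ) (ht : 0 < t.re) (x : ℝ) :
    metaplectic a b c d (fun y => Complex.exp (-Real.pi * t * (y : ℂ) ^ 2
        + 2 * Real.pi * β * y + γ)) x =
      (Complex.I * (b : ℂ)) ^ (-(1/2) : ℂ) * ((t - Complex.I * (a / b))⁻¹ ^ (1/2 : ℂ) *
        Complex.exp (Real.pi * Complex.I * (d / b) * (x : ℂ) ^ 2 + γ
          + Real.pi * (β - Complex.I * x / b) ^ 2 / (t - Complex.I * (a / b)))) := by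
  have hre : (t - Complex.I * (a / b)).re = t.re := by
    rw [← Complex.ofReal_div]; simp
  have hτ : t - Complex.I * (a / b) ≠ 0 := fun h => by
    rw [h] at hre; simp at hre; linarith
  have hb' : (b : ℂ) ≠ 0 := by exact_mod_cast hb
  have hpi : (Real.pi : ℂ) ≠ 0 := by exact_mod_cast Real.pi_ne_zero
  rw [metaplectic, if_pos hb]
  congr 1
  set τ := t - Complex.I * (a / b) with hτdef
  have hB : (-Real.pi * τ : ℂ).re < 0 := by
    have : (-Real.pi * τ : ℂ).re = -(Real.pi * t.re) := by
      rw [← hre, ← Complex.ofReal_neg, Complex.re_ofReal_mul]; ring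
    rw [this]; exact neg_neg_of_pos (mul_pos Real.pi_pos ht)
  have key := integral_cexp_quadratic hB (2 * Real.pi * (β - Complex.I * x / b))
    (Real.pi * Complex.I * (d / b) * (x : ℂ) ^ 2 + γ)
  have e1 : (Real.pi : ℂ) / -(-Real.pi * τ) = τ⁻¹ := by field
  have e2 : (Real.pi * Complex.I * (d / b) * (x : ℂ) ^ 2 + γ)
      - (2 * Real.pi * (β - Complex.I * x / b)) ^ 2 / (4 * (-Real.pi * τ))
      = Real.pi * Complex.I * (d / b) * (x : ℂ) ^ 2 + γ
        + Real.pi * (β - Complex.I * x / b) ^ 2 / τ := by field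
  rw [e1, e2] at key
  rw [← key]
  congr 1
  ext y
  rw [← Complex.exp_add, hτdef]
  congr 1
  push_cast
  field

lemma log_I_mul_of_pos {b : ℝ} (hb : 0 < b) :
    Complex.log (Complex.I * b) = (Real.log b : ℂ) + Real.pi / 2 * Complex.I := by
  rw [mul_comm, Complex.log_ofReal_mul hb Complex.I_ne_zero, Complex.log_I]

lemma log_I_mul_of_neg {b : ℝ} (hb : b < 0) :
    Complex.log (Complex.I * b) = (Real.log b : ℂ) - Real.pi / 2 * Complex.I := by
  have : Complex.I * b = ((-b : ℝ) : ℂ) * -Complex.I := by push_cast; ring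
  rw [this, Complex.log_ofReal_mul (by linarith) (neg_ne_zero.2 Complex.I_ne_zero),
    Complex.log_neg_I, Real.log_neg_eq_log]
  ring

lemma log_I_mul_mul {s : ℝ} (hs : s ≠ 0) {τ : ℂ} (hτ : 0 < τ.re) :
    Complex.log (Complex.I * s * τ) = Complex.log (Complex.I * s) + Complex.log τ := by
  have h1 := abs_lt.1 (Complex.abs_arg_lt_pi_div_two_iff.2 (Or.inl hτ))
  have hs' : (s : ℂ) ≠ 0 := by exact_mod_cast hs
  refine Complex.log_mul (mul_ne_zero Complex.I_ne_zero hs') (fun h => by simp [h] at hτ) ?_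
  rw [← Complex.log_im (Complex.I * s)]
  rcases lt_or_gt_of_ne hs with h | h
  · have : (Complex.log (Complex.I * s)).im = -(Real.pi / 2) := by
      rw [log_I_mul_of_neg h, ← Complex.ofReal_ofNat, ← Complex.ofReal_div]
      simp only [Complex.sub_im, Complex.ofReal_im, Complex.im_ofReal_mul, Complex.I_im]
      ring
    rw [this]
    constructor <;> linarith
  · have : (Complex.log (Complex.I * s)).im = Real.pi / 2 := by
      rw [log_I_mul_of_pos h, ← Complex.ofReal_ofNat, ← Complex.ofReal_div]
      simp only [Complex.add_im, Complex.ofReal_im, Complex.im_ofReal_mul, Complex.I_im]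
      ring
    rw [this]
    constructor <;> linarith

lemma inv_cpow_half_of_re_pos {τ : ℂ} (hτ : 0 < τ.re) :
    τ⁻¹ ^ (1/2 : ℂ) = τ ^ (-(1/2) : ℂ) := by
  rw [Complex.inv_cpow _ _ (fun h => ?_), Complex.cpow_neg]
  rw [Complex.arg_eq_pi_iff] at h
  linarith [h.1]

lemma I_mul_cpow_neg_half_mul {a b : ℝ} (ha : a ≠ 0) (hb : b ≠ 0) {τ : ℂ} (hτ : 0 < τ.re) :
    (Complex.I * b) ^ (-(1/2) : ℂ) * (Complex.I * ((-a / b : ℝ) : ℂ) * τ) ^ (-(1/2) : ℂ) =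
      (if a < 0 ∧ 0 ≤ b then (-1 : ℂ) else 1) * Complex.exp (Real.pi * Complex.I / 4) *
        ((Complex.I * a) ^ (-(1/2) : ℂ) * τ ^ (-(1/2) : ℂ)) := by
  have ha' : (a : ℂ) ≠ 0 := by exact_mod_cast ha
  have hb' : (b : ℂ) ≠ 0 := by exact_mod_cast hb
  have hs : -a / b ≠ 0 := div_ne_zero (neg_ne_zero.2 ha) hb
  have hs' : ((-a / b : ℝ) : ℂ) ≠ 0 := by exact_mod_cast hs
  have hτ0 : τ ≠ 0 := fun h => by simp [h] at hτ
  have hI := Complex.I_ne_zero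
  have hlog : Real.log (-a / b) = Real.log a - Real.log b := by
    rw [neg_div, Real.log_neg_eq_log, Real.log_div ha hb]
  rw [Complex.cpow_def_of_ne_zero (mul_ne_zero hI hb'),
    Complex.cpow_def_of_ne_zero (mul_ne_zero (mul_ne_zero hI hs') hτ0),
    Complex.cpow_def_of_ne_zero (mul_ne_zero hI ha'), Complex.cpow_def_of_ne_zero hτ0,
    log_I_mul_mul hs hτ]
  rcases lt_or_gt_of_ne ha with ha | ha <;> rcases lt_or_gt_of_ne hb with hb | hb
  · have hs : -a / b < 0 := div_neg_of_pos_of_neg (by linarith) hb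
    rw [if_neg (by intro h; linarith [h.2]), log_I_mul_of_neg ha, log_I_mul_of_neg hb,
      log_I_mul_of_neg hs, hlog, one_mul, ← Complex.exp_add, ← Complex.exp_add, ← Complex.exp_add]
    congr 1
    push_cast
    ring
  · have hs : 0 < -a / b := div_pos (by linarith) hb
    rw [if_pos ⟨ha, hb.le⟩, log_I_mul_of_neg ha, log_I_mul_of_pos hb,
      log_I_mul_of_pos hs, hlog, ← Complex.exp_pi_mul_I, ← Complex.exp_add, ← Complex.exp_add,
      ← Complex.exp_add, ← Complex.exp_add, Complex.exp_eq_exp_iff_exists_int]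
    refine ⟨-1, ?_⟩
    push_cast
    ring
  · have hs : 0 < -a / b := div_pos_of_neg_of_neg (by linarith) hb
    rw [if_neg (by intro h; linarith [h.1]), log_I_mul_of_pos ha, log_I_mul_of_neg hb,
      log_I_mul_of_pos hs, hlog, one_mul, ← Complex.exp_add, ← Complex.exp_add, ← Complex.exp_add]
    congr 1
    push_cast
    ring
  · have hs : -a / b < 0 := div_neg_of_neg_of_pos (by linarith) hb
    rw [if_neg (by intro h; linarith [h.1]), log_I_mul_of_pos ha, log_I_mul_of_pos hb,
      log_I_mul_of_neg hs, hlog, one_mul, ← Complex.exp_add, ← Complex.exp_add, ← Complex.exp_add]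
    congr 1
    push_cast
    ring

/-- Poisson summation for a Gaussian with a constant term in the exponent. -/
lemma tsum_cexp_quadratic {α : ℂ} (hα : 0 < α.re) (β γ : ℂ) :
    ∑' n : ℤ, Complex.exp (-Real.pi * α * n ^ 2 + 2 * Real.pi * β * n + γ) =
      α ^ (-(1/2) : ℂ) *
        ∑' n : ℤ, Complex.exp (-Real.pi / α * (n + Complex.I * β) ^ 2 + γ) := by
  simp_rw [Complex.exp_add _ γ, tsum_mul_right]
  rw [Complex.tsum_exp_neg_quadratic hα, Complex.cpow_neg, one_div, mul_assoc]

lemma tsum_metaplectic_gaussian_of_ne_zero {a b c d : ℝ} (hdet : a * d - b * c = 1)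
    (ha : a ≠ 0) (hb : b ≠ 0) (β γ : ℂ) :
    ∑' n : ℤ, metaplectic d b c a (fun y => Complex.exp (-Real.pi *
        (1 + (d / b : ℝ) * Complex.I) * (y : ℂ) ^ 2 + 2 * Real.pi * β * y + γ)) n =
      (if a < 0 ∧ 0 ≤ b then (-1 : ℂ) else 1) * Complex.exp (Real.pi * Complex.I / 4) *
        ∑' n : ℤ, metaplectic c a (-d) (-b) (fun y => Complex.exp (-Real.pi *
          (1 + (d / b : ℝ) * Complex.I) * (y : ℂ) ^ 2 + 2 * Real.pi * β * y + γ)) n := by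
  have ha' : (a : ℂ) ≠ 0 := by exact_mod_cast ha
  have hb' : (b : ℂ) ≠ 0 := by exact_mod_cast hb
  have hdet' : (a * d - b * c : ℂ) = 1 := by exact_mod_cast hdet
  have ht : 0 < (1 + (d / b : ℝ) * Complex.I).re := by simp
  simp_rw [metaplectic_gaussian _ _ _ _ hb _ _ _ ht, metaplectic_gaussian _ _ _ _ ha _ _ _ ht]
  have hone : 1 + (d / b : ℝ) * Complex.I - Complex.I * (d / b) = 1 := by push_cast; ring
  obtain ⟨τ, hτ⟩ : ∃ τ, τ = 1 + (d / b : ℝ) * Complex.I - Complex.I * (c / a) := ⟨_, rfl⟩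
  have hre : 0 < τ.re := by rw [hτ, ← Complex.ofReal_div]; simp
  have hτ0 : τ ≠ 0 := fun h => by simp [h] at hre
  have habτ : a * b * τ = a * b + Complex.I := by
    rw [hτ]; push_cast; field_simp; linear_combination Complex.I * hdet'
  obtain ⟨α, hα⟩ : ∃ α, α = Complex.I * ((-a / b : ℝ) : ℂ) * τ := ⟨_, rfl⟩
  have hα' : α = 1 / b ^ 2 - Complex.I * a / b := by
    rw [hα]; push_cast; field_simp
    linear_combination -Complex.I * habτ - Complex.I_sq
  have hαre : 0 < α.re := by
    have : α = ((1 / b ^ 2 : ℝ) : ℂ) - ((a / b : ℝ) : ℂ) * Complex.I := by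
      rw [hα']; push_cast; ring
    rw [this, Complex.sub_re, Complex.re_ofReal_mul, Complex.I_re, mul_zero, sub_zero,
      Complex.ofReal_re]
    positivity
  have hI2 := Complex.I_sq
  rw [hone, ← hτ, inv_one, Complex.one_cpow, inv_cpow_half_of_re_pos hre]
  simp_rw [one_mul, tsum_mul_left]
  have e1 : ∀ n : ℤ, Real.pi * Complex.I * (a / b) * (((n : ℝ) : ℂ)) ^ 2 + γ
      + Real.pi * (β - Complex.I * ((n : ℝ) : ℂ) / b) ^ 2 / 1 =
      -Real.pi * α * n ^ 2 + 2 * Real.pi * (-Complex.I * β / b) * n + (γ + Real.pi * β ^ 2) := by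
    intro n
    rw [hα']
    push_cast
    linear_combination (Real.pi * n ^ 2 / b ^ 2 : ℂ) * hI2
  have e2 : ∀ n : ℤ, -Real.pi / α * (n + Complex.I * (-Complex.I * β / b)) ^ 2
      + (γ + Real.pi * β ^ 2) =
      Real.pi * Complex.I * (((-b : ℝ) : ℂ) / a) * (((n : ℝ) : ℂ)) ^ 2 + γ
        + Real.pi * (β - Complex.I * ((n : ℝ) : ℂ) / a) ^ 2 / τ := by
    intro n
    have e3 : Complex.I * (-Complex.I * β / b) = β / b := by
      linear_combination (-β / b : ℂ) * hI2
    have e4 : -Real.pi / α = -Real.pi * Complex.I * b / (a * τ) := by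
      have hI := Complex.I_ne_zero
      rw [hα]; push_cast; field_simp; linear_combination hI2
    rw [e3, e4]
    push_cast
    field_simp
    linear_combination (Real.pi * (a * β ^ 2 + Complex.I * b * n ^ 2) : ℂ) * habτ
  simp_rw [e1]
  rw [tsum_cexp_quadratic hαre]
  simp_rw [e2]
  rw [← mul_assoc, hα, I_mul_cpow_neg_half_mul ha hb hre]
  ring

lemma I_cpow_neg_half : Complex.I ^ (-(1/2) : ℂ) = Complex.exp (-(Real.pi * Complex.I / 4)) := by
  rw [Complex.cpow_def_of_ne_zero Complex.I_ne_zero, Complex.log_I]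
  congr 1; ring

lemma neg_I_cpow_neg_half :
    (-Complex.I) ^ (-(1/2) : ℂ) = Complex.exp (Real.pi * Complex.I / 4) := by
  rw [Complex.cpow_def_of_ne_zero (neg_ne_zero.2 Complex.I_ne_zero), Complex.log_neg_I]
  congr 1; ring

lemma exp_pi_I_div_four_sq : Complex.exp (Real.pi * Complex.I / 4) ^ 2 = Complex.I := by
  rw [← Complex.exp_nat_mul]
  refine Eq.trans ?_ Complex.exp_pi_div_two_mul_I
  congr 1; push_cast; ring

lemma tsum_metaplectic_gaussian_of_upper_left_zero {b c d : ℝ}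
    (h : b = 1 ∧ c = -1 ∨ b = -1 ∧ c = 1) (β γ : ℂ) :
    ∑' n : ℤ, metaplectic d b c 0 (fun y => Complex.exp (-Real.pi *
        (1 + (d / b : ℝ) * Complex.I) * (y : ℂ) ^ 2 + 2 * Real.pi * β * y + γ)) n =
      Complex.exp (Real.pi * Complex.I / 4) *
        ∑' n : ℤ, metaplectic c 0 (-d) (-b) (fun y => Complex.exp (-Real.pi *
          (1 + (d / b : ℝ) * Complex.I) * (y : ℂ) ^ 2 + 2 * Real.pi * β * y + γ)) n := by
  have hb : b ≠ 0 := by rcases h with h | h <;> simp [h.1]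
  have hb' : (b : ℂ) ≠ 0 := by exact_mod_cast hb
  have hb2 : (b : ℂ) ^ 2 = 1 := by rcases h with h | h <;> simp [h.1]
  have hinv : (b : ℂ)⁻¹ = b := by
    rw [inv_eq_iff_eq_inv]; field_simp; exact hb2
  have hc : c = -b := by rcases h with h | h <;> simp [h.1, h.2]
  have ht : 0 < (1 + (d / b : ℝ) * Complex.I).re := by simp
  have hI2 := Complex.I_sq
  simp_rw [metaplectic_gaussian _ _ _ _ hb _ _ _ ht]
  have hone : 1 + (d / b : ℝ) * Complex.I - Complex.I * (d / b) = 1 := by push_cast; ring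
  rw [hone, inv_one, Complex.one_cpow]
  simp_rw [one_mul, tsum_mul_left]
  have e1 : ∀ n : ℤ, Real.pi * Complex.I * (((0 : ℝ) : ℂ) / b) * (((n : ℝ) : ℂ)) ^ 2 + γ
      + Real.pi * (β - Complex.I * ((n : ℝ) : ℂ) / b) ^ 2 / 1 =
      -Real.pi * 1 * n ^ 2 + 2 * Real.pi * (-Complex.I * β / b) * n + (γ + Real.pi * β ^ 2) := by
    intro n
    push_cast
    rw [div_eq_mul_inv _ (b : ℂ), div_eq_mul_inv _ (b : ℂ), div_eq_mul_inv _ (b : ℂ), hinv]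
    linear_combination (Real.pi * n ^ 2 * b ^ 2 : ℂ) * hI2 - (Real.pi * n ^ 2 : ℂ) * hb2
  have e2 : ∀ n : ℤ, -Real.pi / 1 * (n + Complex.I * (-Complex.I * β / b)) ^ 2
      + (γ + Real.pi * β ^ 2) =
      Real.pi * Complex.I * ((-d / c : ℝ) : ℂ) * (((n : ℝ) : ℂ)) ^ 2
        + (-Real.pi * (1 + (d / b : ℝ) * Complex.I) * (((n : ℝ) / c : ℝ) : ℂ) ^ 2
          + 2 * Real.pi * β * (((n : ℝ) / c : ℝ) : ℂ) + γ) := by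
    intro n
    have e3 : Complex.I * (-Complex.I * β / b) = β / b := by
      linear_combination (-β / b : ℂ) * hI2
    rw [e3, hc]
    push_cast
    simp only [div_neg, neg_div, neg_neg, div_one]
    simp only [div_eq_mul_inv, hinv]
    linear_combination (-Real.pi * β ^ 2 + Real.pi * (1 + d * b * Complex.I) * n ^ 2) * hb2
  simp_rw [e1]
  rw [tsum_cexp_quadratic (by simp)]
  simp_rw [e2, Complex.one_cpow, one_mul]
  have hsum : ∀ n : ℤ, metaplectic c 0 (-d) (-b) (fun y => Complex.exp (-Real.pi *
      (1 + (d / b : ℝ) * Complex.I) * (y : ℂ) ^ 2 + 2 * Real.pi * β * y + γ)) n =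
      (if 0 < c then 1 else -Complex.I) *
        Complex.exp (Real.pi * Complex.I * ((-d / c : ℝ) : ℂ) * (((n : ℝ) : ℂ)) ^ 2
        + (-Real.pi * (1 + (d / b : ℝ) * Complex.I) * (((n : ℝ) / c : ℝ) : ℂ) ^ 2
          + 2 * Real.pi * β * (((n : ℝ) / c : ℝ) : ℂ) + γ)) := by
    intro n
    rw [metaplectic, if_neg (by simp)]
    rcases h with ⟨_, rfl⟩ | ⟨_, rfl⟩ <;> norm_num [mul_assoc, Complex.exp_add]
  simp_rw [hsum, tsum_mul_left]
  rw [← mul_assoc]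
  congr 1
  rcases h with ⟨rfl, rfl⟩ | ⟨rfl, rfl⟩
  · rw [if_neg (by norm_num), Complex.ofReal_one, mul_one, I_cpow_neg_half, Complex.exp_neg]
    have h0 := Complex.exp_ne_zero (Real.pi * Complex.I / 4)
    field_simp
    rw [exp_pi_I_div_four_sq]
    linear_combination hI2
  · rw [if_pos (by norm_num), Complex.ofReal_neg, Complex.ofReal_one, mul_neg_one,
      neg_I_cpow_neg_half, mul_one]

lemma tsum_metaplectic_gaussian_of_upper_right_zero {a c d : ℝ}
    (h : a = 1 ∧ d = 1 ∨ a = -1 ∧ d = -1) (β γ : ℂ) :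
    ∑' n : ℤ, metaplectic d 0 c a (fun y => Complex.exp (-Real.pi *
        (1 + (d / (0 : ℝ) : ℝ) * Complex.I) * (y : ℂ) ^ 2 + 2 * Real.pi * β * y + γ)) n =
      (if a < 0 then (-1 : ℂ) else 1) * Complex.exp (Real.pi * Complex.I / 4) *
        ∑' n : ℤ, metaplectic c a (-d) (-0) (fun y => Complex.exp (-Real.pi *
          (1 + (d / (0 : ℝ) : ℝ) * Complex.I) * (y : ℂ) ^ 2 + 2 * Real.pi * β * y + γ)) n := by
  have ha : a ≠ 0 := by rcases h with h | h <;> simp [h.1]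
  have ha' : (a : ℂ) ≠ 0 := by exact_mod_cast ha
  have ha2 : (a : ℂ) ^ 2 = 1 := by rcases h with h | h <;> simp [h.1]
  have hinv : (a : ℂ)⁻¹ = a := by
    rw [inv_eq_iff_eq_inv]; field_simp; exact ha2
  have hd : d = a := by rcases h with h | h <;> simp [h.1, h.2]
  have hI2 := Complex.I_sq
  subst hd
  rw [div_zero, Complex.ofReal_zero, zero_mul, add_zero]
  simp_rw [metaplectic_gaussian _ _ _ _ ha _ _ _ (by simp : (0 : ℝ) < (1 : ℂ).re)]
  obtain ⟨τ, hτ⟩ : ∃ τ, τ = 1 - Complex.I * (c / d) := ⟨_, rfl⟩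
  have hre : 0 < τ.re := by rw [hτ, ← Complex.ofReal_div]; simp
  rw [← hτ, inv_cpow_half_of_re_pos hre]
  simp_rw [tsum_mul_left]
  have hsum : ∀ n : ℤ, metaplectic d 0 c d (fun y => Complex.exp (-Real.pi *
      1 * (y : ℂ) ^ 2 + 2 * Real.pi * β * y + γ)) n =
      (if 0 < d then 1 else -Complex.I) *
        Complex.exp (-Real.pi * τ * n ^ 2 + 2 * Real.pi * (β / d) * n + γ) := by
    intro n
    have e : -Real.pi * τ * n ^ 2 + 2 * Real.pi * (β / d) * n + γ =
        Real.pi * Complex.I * ((c / d : ℝ) : ℂ) * (((n : ℝ) : ℂ)) ^ 2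
        + (-Real.pi * 1 * (((n : ℝ) / d : ℝ) : ℂ) ^ 2
          + 2 * Real.pi * β * (((n : ℝ) / d : ℝ) : ℂ) + γ) := by
      rw [hτ]
      push_cast
      simp only [div_eq_mul_inv, hinv]
      linear_combination (Real.pi * n ^ 2) * ha2
    rw [metaplectic, if_neg (by simp), e]
    rcases h with ⟨rfl, _⟩ | ⟨rfl, _⟩ <;> norm_num [mul_assoc, Complex.exp_add]
  simp_rw [hsum, tsum_mul_left]
  rw [tsum_cexp_quadratic hre]
  have e2 : ∀ n : ℤ, -Real.pi / τ * (n + Complex.I * (β / d)) ^ 2 + γ =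
      Real.pi * Complex.I * (((-0 : ℝ) : ℂ) / d) * (((n : ℝ) : ℂ)) ^ 2 + γ
        + Real.pi * (β - Complex.I * ((n : ℝ) : ℂ) / d) ^ 2 / τ := by
    intro n
    push_cast
    simp only [div_eq_mul_inv, hinv]
    linear_combination (-Real.pi * τ⁻¹ * n ^ 2 - Real.pi * τ⁻¹ * β ^ 2 * d ^ 2
      - Real.pi * τ⁻¹ * n ^ 2 * (d ^ 2 - 1) : ℂ) * hI2
      + (Real.pi * τ⁻¹ * (β ^ 2 + n ^ 2)) * ha2
  simp_rw [e2]
  rw [← mul_assoc, ← mul_assoc, ← mul_assoc]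
  congr 2
  rcases h with ⟨rfl, _⟩ | ⟨rfl, _⟩
  · rw [if_pos (by norm_num), if_neg (by norm_num), Complex.ofReal_one, mul_one, I_cpow_neg_half,
      one_mul, ← Complex.exp_add, add_neg_cancel, Complex.exp_zero]
  · rw [if_neg (by norm_num), if_pos (by norm_num), Complex.ofReal_neg, Complex.ofReal_one,
      mul_neg_one, neg_I_cpow_neg_half, mul_assoc, ← sq, exp_pi_I_div_four_sq]
    ring

lemma tsum_metaplectic_gaussian {a b c d : ℤ} (hdet : a * d - b * c = 1) (β γ : ℂ) :
    ∑' n : ℤ, metaplectic d b c a (fun y => Complex.exp (-Real.pi *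
        (1 + ((d : ℝ) / (b : ℝ) : ℝ) * Complex.I) * (y : ℂ) ^ 2 + 2 * Real.pi * β * y + γ)) n =
      (if a < 0 ∧ 0 ≤ b then (-1 : ℂ) else 1) * Complex.exp (Real.pi * Complex.I / 4) *
        ∑' n : ℤ, metaplectic c a (-d) (-b) (fun y => Complex.exp (-Real.pi *
          (1 + ((d : ℝ) / (b : ℝ) : ℝ) * Complex.I) * (y : ℂ) ^ 2
            + 2 * Real.pi * β * y + γ)) n := by
  rcases eq_or_ne b 0 with rfl | hb
  · have had : a * d = 1 := by simpa using hdet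
    have h := Int.mul_eq_one_iff_eq_one_or_neg_one.1 had
    have h' : (a : ℝ) = 1 ∧ (d : ℝ) = 1 ∨ (a : ℝ) = -1 ∧ (d : ℝ) = -1 := by exact_mod_cast h
    simpa using tsum_metaplectic_gaussian_of_upper_right_zero (c := c) h' β γ
  rcases eq_or_ne a 0 with rfl | ha
  · have hbc : b * -c = 1 := by linarith
    have h := Int.mul_eq_one_iff_eq_one_or_neg_one.1 hbc
    have h' : (b : ℝ) = 1 ∧ (c : ℝ) = -1 ∨ (b : ℝ) = -1 ∧ (c : ℝ) = 1 := by
      rcases h with h | h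
      · left; constructor <;> norm_cast <;> omega
      · right; constructor <;> norm_cast <;> omega
    simpa using tsum_metaplectic_gaussian_of_upper_left_zero (d := d) h' β γ
  · have h := tsum_metaplectic_gaussian_of_ne_zero (a := a) (b := b) (c := c) (d := d)
      (by exact_mod_cast hdet) (by exact_mod_cast ha) (by exact_mod_cast hb) β γ
    have hiff : ((a : ℝ) < 0 ∧ (0 : ℝ) ≤ b) ↔ (a < 0 ∧ 0 ≤ b) := by norm_cast
    simpa only [hiff] using h

lemma shift_chirpedGaussian (r q p x : ℝ) :
    Complex.exp ((Real.pi : ℂ) * Complex.I * (q : ℂ) * (p : ℂ) / 4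
        + (Real.pi : ℂ) * Complex.I * (p : ℂ) * (x : ℂ)) * chirpedGaussian r (x + q / 2) =
      Complex.exp (-Real.pi * (1 + r * Complex.I) * (x : ℂ) ^ 2
        + 2 * Real.pi * ((Complex.I * p - (1 + r * Complex.I) * q) / 2) * x
        + (Real.pi * Complex.I * q * p / 4 - Real.pi * (1 + r * Complex.I) * q ^ 2 / 4)) := by
  rw [chirpedGaussian_apply, ← Complex.exp_add]
  congr 1
  push_cast
  ring

/-- Transformation of the eigenvalue `μ` under right multiplication by
`F₁ = (0 1; -1 0)`: `μ(M; (q,p)) = σ e^{πi/4} μ(M F₁; (q,p))`. -/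
theorem stmt6 (a b c d q p : ℤ) (hdet : a * d - b * c = 1)
    (hq : q ≡ a * b [ZMOD 2]) (hp : p ≡ c * d [ZMOD 2]) (μ₁ μ₂ : ℂ)
    (h1 : ∀ f : SchwartzMap ℝ ℂ,
      shiftMetaPair (a : ℝ) (b : ℝ) (c : ℝ) (d : ℝ) (q : ℝ) (p : ℝ) (⇑f)
        = μ₁ * ∑' n : ℤ, f (n : ℝ))
    (h2 : ∀ f : SchwartzMap ℝ ℂ,
      shiftMetaPair (-(b : ℝ)) (a : ℝ) (-(d : ℝ)) (c : ℝ) (q : ℝ) (p : ℝ) (⇑f)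
        = μ₂ * ∑' n : ℤ, f (n : ℝ)) :
    μ₁ = (if a < 0 ∧ 0 ≤ b then (-1 : ℂ) else 1)
      * Complex.exp ((Real.pi : ℂ) * Complex.I / 4) * μ₂ := by
  have h := tsum_metaplectic_gaussian hdet
    ((Complex.I * (p : ℝ) - (1 + ((d : ℝ) / (b : ℝ) : ℝ) * Complex.I) * (q : ℝ)) / 2)
    (Real.pi * Complex.I * (q : ℝ) * (p : ℝ) / 4
      - Real.pi * (1 + ((d : ℝ) / (b : ℝ) : ℝ) * Complex.I) * (q : ℝ) ^ 2 / 4)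
  simp_rw [← shift_chirpedGaussian] at h
  have h1' := h1 (chirpedGaussian ((d : ℝ) / b))
  have h2' := h2 (chirpedGaussian ((d : ℝ) / b))
  rw [shiftMetaPair] at h1' h2'
  rw [h1', h2', ← mul_assoc] at h
  exact mul_right_cancel₀ (tsum_chirpedGaussian_ne_zero _) h
end
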